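/- There exist absolute constants c, C > 0 such that the following holds. For every integer n ≥ 1, every real q with 0 < q < 1, and every s ∈ {1,…,n}, if π is a random permutation with the Mallows distribution μ_{n,q}, then c · min{(1−q)^{−2}, n} ≤ E[|C_s(π)|] ≤ C · min{(1−q)^{−2}, n}. -/

import Mathlib

open Finset
open scoped Classical BigOperators

noncomputable section

/-- Number of inversions of a permutation of `Fin n` (0-indexed positions). -/
def invCount (n : ℕ) (π : Equiv.Perm (Fin n)) : ℕ :=
  ((Finset.univ : Finset (Fin n × Fin n)).filter
    (fun p => p.1 < p.2 ∧ π p.2 < π p.1)).card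

/-- Normalizing constant of the Mallows distribution. -/
def mallowsZ (n : ℕ) (q : ℝ) : ℝ :=
  ∑ σ : Equiv.Perm (Fin n), q ^ invCount n σ

/-- Mallows probability of an individual permutation. -/
def mallowsP (n : ℕ) (q : ℝ) (π : Equiv.Perm (Fin n)) : ℝ :=
  q ^ invCount n π / mallowsZ n q

/-- Expectation of a real-valued functional under the Mallows distribution. -/
def mExp (n : ℕ) (q : ℝ) (X : Equiv.Perm (Fin n) → ℝ) : ℝ :=
  ∑ π : Equiv.Perm (Fin n), mallowsP n q π * X π

/-- Probability of an event under the Mallows distribution. -/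
def mProb (n : ℕ) (q : ℝ) (A : Equiv.Perm (Fin n) → Prop) : ℝ :=
  ∑ π : Equiv.Perm (Fin n), if A π then mallowsP n q π else 0

/-- Conditional probability of `A` given `B` under the Mallows distribution. -/
def mCondProb (n : ℕ) (q : ℝ) (A B : Equiv.Perm (Fin n) → Prop) : ℝ :=
  mProb n q (fun π => A π ∧ B π) / mProb n q B

/-- The set of points of the cycle of `π` containing `s`. -/
def cycleSet (n : ℕ) (π : Equiv.Perm (Fin n)) (s : Fin n) : Finset (Fin n) :=
  Finset.univ.filter (fun t => π.SameCycle s t)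

lemma self_mem_cycleSet (n : ℕ) (π : Equiv.Perm (Fin n)) (s : Fin n) :
    s ∈ cycleSet n π s :=
  Finset.mem_filter.mpr ⟨Finset.mem_univ _, Equiv.Perm.SameCycle.refl _ _⟩

/-- Maximal element of the cycle of `s`, in 1-indexed labelling `{1,…,n}`. -/
def cycMax (n : ℕ) (π : Equiv.Perm (Fin n)) (s : Fin n) : ℕ :=
  (cycleSet n π s).sup (fun t => (t : ℕ) + 1)

/-- Minimal element of the cycle of `s`, in 1-indexed labelling `{1,…,n}`. -/
def cycMin (n : ℕ) (π : Equiv.Perm (Fin n)) (s : Fin n) : ℕ :=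
  (cycleSet n π s).inf' ⟨s, self_mem_cycleSet n π s⟩ (fun t => (t : ℕ) + 1)

/-! ### Basic expectation facts -/

/-- real indicator -/
def ind (P : Prop) : ℝ := if P then 1 else 0

lemma ind_nonneg (P : Prop) : 0 ≤ ind P := by unfold ind; split_ifs <;> norm_num
lemma ind_le_one (P : Prop) : ind P ≤ 1 := by unfold ind; split_ifs <;> norm_num
lemma ind_true {P : Prop} (h : P) : ind P = 1 := by simp [ind, h]
lemma ind_false {P : Prop} (h : ¬ P) : ind P = 0 := by simp [ind, h]
lemma ind_mono {P Q : Prop} (h : P → Q) : ind P ≤ ind Q := by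
  by_cases hP : P
  · rw [ind_true hP, ind_true (h hP)]
  · rw [ind_false hP]; exact ind_nonneg _

lemma mallowsZ_pos (n : ℕ) {q : ℝ} (hq : 0 < q) : 0 < mallowsZ n q :=
  Finset.sum_pos (fun _ _ => pow_pos hq _) ⟨1, Finset.mem_univ _⟩

lemma mallowsP_nonneg (n : ℕ) {q : ℝ} (hq : 0 < q) (π : Equiv.Perm (Fin n)) :
    0 ≤ mallowsP n q π := div_nonneg (pow_pos hq _).le (mallowsZ_pos n hq).le

lemma mExp_mono {n : ℕ} {q : ℝ} (hq : 0 < q) {X Y : Equiv.Perm (Fin n) → ℝ}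
    (h : ∀ π, X π ≤ Y π) : mExp n q X ≤ mExp n q Y :=
  Finset.sum_le_sum fun π _ => mul_le_mul_of_nonneg_left (h π) (mallowsP_nonneg n hq π)

lemma mExp_congr {n : ℕ} {q : ℝ} {X Y : Equiv.Perm (Fin n) → ℝ}
    (h : ∀ π, X π = Y π) : mExp n q X = mExp n q Y := by
  have : X = Y := funext h
  rw [this]

lemma mExp_const {n : ℕ} {q : ℝ} (hq : 0 < q) (c : ℝ) : mExp n q (fun _ => c) = c := by
  unfold mExp mallowsP
  rw [← Finset.sum_mul, ← Finset.sum_div]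
  change mallowsZ n q / mallowsZ n q * c = c
  rw [div_self (mallowsZ_pos n hq).ne', one_mul]

lemma mExp_add {n : ℕ} {q : ℝ} (X Y : Equiv.Perm (Fin n) → ℝ) :
    mExp n q (fun π => X π + Y π) = mExp n q X + mExp n q Y := by
  simp [mExp, mul_add, Finset.sum_add_distrib]

lemma mExp_sub {n : ℕ} {q : ℝ} (X Y : Equiv.Perm (Fin n) → ℝ) :
    mExp n q (fun π => X π - Y π) = mExp n q X - mExp n q Y := by
  simp [mExp, mul_sub, Finset.sum_sub_distrib]

lemma mExp_smul {n : ℕ} {q : ℝ} (c : ℝ) (X : Equiv.Perm (Fin n) → ℝ) :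
    mExp n q (fun π => c * X π) = c * mExp n q X := by
  simp only [mExp, Finset.mul_sum]
  exact Finset.sum_congr rfl fun _ _ => by ring

lemma mExp_sum {n : ℕ} {q : ℝ} {ι : Type*} (A : Finset ι) (X : ι → Equiv.Perm (Fin n) → ℝ) :
    mExp n q (fun π => ∑ i ∈ A, X i π) = ∑ i ∈ A, mExp n q (X i) := by
  simp only [mExp, Finset.mul_sum]
  rw [Finset.sum_comm]

lemma mExp_nonneg {n : ℕ} {q : ℝ} (hq : 0 < q) {X : Equiv.Perm (Fin n) → ℝ}
    (h : ∀ π, 0 ≤ X π) : 0 ≤ mExp n q X :=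
  Finset.sum_nonneg fun π _ => mul_nonneg (mallowsP_nonneg n hq π) (h π)

lemma invCount_inv (n : ℕ) (π : Equiv.Perm (Fin n)) : invCount n π⁻¹ = invCount n π := by
  unfold invCount
  refine Finset.card_bij' (fun p _ => (π⁻¹ p.2, π⁻¹ p.1)) (fun p _ => (π p.2, π p.1)) ?_ ?_ ?_ ?_
  · rintro ⟨a, b⟩ h; simpa [and_comm] using h
  · rintro ⟨a, b⟩ h; simpa [and_comm] using h
  · rintro ⟨a, b⟩ h; simp
  · rintro ⟨a, b⟩ h; simp

lemma mExp_inv {n : ℕ} {q : ℝ} (X : Equiv.Perm (Fin n) → ℝ) :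
    mExp n q (fun π => X π⁻¹) = mExp n q X := by
  unfold mExp
  refine Fintype.sum_equiv (Equiv.inv _) _ _ ?_
  intro π
  simp [mallowsP, invCount_inv]

lemma invCount_rev (n : ℕ) (π : Equiv.Perm (Fin n)) :
    invCount n (Fin.revPerm * π * Fin.revPerm) = invCount n π := by
  unfold invCount
  refine Finset.card_bij' (fun p _ => (Fin.rev p.2, Fin.rev p.1))
    (fun p _ => (Fin.rev p.2, Fin.rev p.1)) ?_ ?_ ?_ ?_
  · rintro ⟨a, b⟩ h; simpa using h
  · rintro ⟨a, b⟩ h; simpa using h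
  · rintro ⟨a, b⟩ h; simp
  · rintro ⟨a, b⟩ h; simp

lemma rev_mul_rev (n : ℕ) : (Fin.revPerm * Fin.revPerm : Equiv.Perm (Fin n)) = 1 := by
  ext x; simp

lemma rev_inv (n : ℕ) : (Fin.revPerm : Equiv.Perm (Fin n))⁻¹ = Fin.revPerm := rfl

lemma mExp_rev {n : ℕ} {q : ℝ} (X : Equiv.Perm (Fin n) → ℝ) :
    mExp n q (fun π => X (Fin.revPerm * π * Fin.revPerm)) = mExp n q X := by
  unfold mExp
  refine Fintype.sum_equiv
    ((Equiv.mulRight (Fin.revPerm : Equiv.Perm (Fin n))).trans (Equiv.mulLeft Fin.revPerm)) _ _ ?_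
  intro π
  simp [mallowsP, ← mul_assoc, invCount_rev]

lemma sameCycle_rev {n : ℕ} (π : Equiv.Perm (Fin n)) (x y : Fin n) :
    (Fin.revPerm * π * Fin.revPerm).SameCycle x y ↔ π.SameCycle x.rev y.rev := by
  have := @Equiv.Perm.sameCycle_conj _ π Fin.revPerm x y
  rw [rev_inv] at this
  simpa using this

/-! ### Codes -/

/-- permutations fixing everything below `τ` -/
def FixB {n : ℕ} (τ : ℕ) (h : Equiv.Perm (Fin n)) : Prop := ∀ i : Fin n, (i : ℕ) < τ → h i = i

lemma FixB.lt_iff {n τ : ℕ} {h : Equiv.Perm (Fin n)} (H : FixB τ h) (x : Fin n) :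
    ((h x : Fin n) : ℕ) < τ ↔ (x : ℕ) < τ := by
  constructor
  · intro hx
    have := h.injective (H _ hx)
    rwa [this] at hx
  · intro hx; rwa [H x hx]

lemma FixB.inv {n τ : ℕ} {h : Equiv.Perm (Fin n)} (H : FixB τ h) : FixB τ h⁻¹ := by
  intro i hi
  rw [Equiv.Perm.inv_eq_iff_eq, H i hi]

def RInv {n : ℕ} {α : Type*} (τ : ℕ) (F : Equiv.Perm (Fin n) → α) : Prop :=
  ∀ π h, FixB τ h → F (π * h) = F π

def LInv {n : ℕ} {α : Type*} (τ : ℕ) (F : Equiv.Perm (Fin n) → α) : Prop :=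
  ∀ π h, FixB τ h → F (h * π) = F π

lemma RInv.inv {n : ℕ} {α : Type*} {τ : ℕ} {F : Equiv.Perm (Fin n) → α} (H : RInv τ F) :
    LInv τ (fun π => F π⁻¹) := by
  intro π h hh
  simp only [mul_inv_rev]
  exact H _ _ hh.inv

lemma LInv.inv {n : ℕ} {α : Type*} {τ : ℕ} {F : Equiv.Perm (Fin n) → α} (H : LInv τ F) :
    RInv τ (fun π => F π⁻¹) := by
  intro π h hh
  simp only [mul_inv_rev]
  exact H _ _ hh.inv

/-- rank of value `v` among the values at positions `≥ τ` -/
def rk {n : ℕ} (τ : ℕ) (π : Equiv.Perm (Fin n)) (v : Fin n) : ℕ :=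
  (Finset.univ.filter (fun j : Fin n => τ ≤ (j : ℕ) ∧ π j < v)).card

lemma rk_mul_right {n τ : ℕ} (π h : Equiv.Perm (Fin n)) (H : FixB τ h) (v : Fin n) :
    rk τ (π * h) v = rk τ π v := by
  unfold rk
  refine Finset.card_bij' (fun j _ => h j) (fun j _ => h⁻¹ j) ?_ ?_ ?_ ?_
  · intro j hj
    simp only [Finset.mem_filter, Finset.mem_univ, true_and] at hj ⊢
    try simp only [Equiv.Perm.mul_apply] at hj ⊢
    have := H.lt_iff j
    exact ⟨by omega, hj.2⟩
  · intro j hj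
    simp only [Finset.mem_filter, Finset.mem_univ, true_and] at hj ⊢
    try simp only [Equiv.Perm.mul_apply] at hj ⊢
    have := H.inv.lt_iff j
    exact ⟨by omega, by simpa using hj.2⟩
  · intro j _; simp
  · intro j _; simp

lemma rk_mul_left {n τ : ℕ} (π h : Equiv.Perm (Fin n)) (H : FixB τ h) (v : Fin n)
    (hv : (v : ℕ) ≤ τ) : rk τ (h * π) v = rk τ π v := by
  unfold rk
  congr 1
  ext j
  simp only [Finset.mem_filter, Finset.mem_univ, true_and]
  simp only [Equiv.Perm.mul_apply]
  refine and_congr_right fun _ => ?_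
  constructor
  · intro hj
    have h1 : ((h (π j) : Fin n) : ℕ) < τ := lt_of_lt_of_le hj hv
    have h2 := (H.lt_iff _).1 h1
    rwa [H _ h2] at hj
  · intro hj
    have h1 : ((π j : Fin n) : ℕ) < τ := lt_of_lt_of_le hj hv
    rwa [H _ h1]

lemma rk_strict {n τ : ℕ} (π : Equiv.Perm (Fin n)) {j j' : Fin n} (hj : τ ≤ (j : ℕ))
    (h : π j < π j') : rk τ π (π j) < rk τ π (π j') := by
  unfold rk
  apply Finset.card_lt_card
  rw [Finset.ssubset_iff_of_subset]
  · exact ⟨j, by simp [hj, h], by simp⟩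
  · intro x hx
    simp only [Finset.mem_filter, Finset.mem_univ, true_and] at hx ⊢
    exact ⟨hx.1, hx.2.trans h⟩

lemma rk_inj {n τ : ℕ} (π : Equiv.Perm (Fin n)) {j j' : Fin n} (hj : τ ≤ (j : ℕ))
    (hj' : τ ≤ (j' : ℕ)) (h : rk τ π (π j) = rk τ π (π j')) : j = j' := by
  rcases lt_trichotomy (π j) (π j') with h1 | h1 | h1
  · have := rk_strict π hj h1; omega
  · exact π.injective h1
  · have := rk_strict π hj' h1; omega

lemma card_ge {n : ℕ} (τ : ℕ) :
    (Finset.univ.filter (fun j : Fin n => τ ≤ (j : ℕ))).card = n - τ := by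
  have : (Finset.univ.filter (fun j : Fin n => τ ≤ (j : ℕ))).card
      = ((Finset.univ.filter (fun j : Fin n => τ ≤ (j : ℕ))).map Fin.valEmbedding).card := by
    rw [Finset.card_map]
  rw [this]
  have h2 : (Finset.univ.filter (fun j : Fin n => τ ≤ (j : ℕ))).map Fin.valEmbedding
      = Finset.Ico τ n := by
    ext x
    simp only [Finset.mem_map, Finset.mem_filter, Finset.mem_univ, true_and, Finset.mem_Ico,
      Fin.valEmbedding_apply]
    constructor
    · rintro ⟨a, ha, rfl⟩; exact ⟨ha, a.2⟩
    · rintro ⟨h1, h2⟩; exact ⟨⟨x, h2⟩, h1, rfl⟩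
  rw [h2, Nat.card_Ico]

lemma rk_lt {n τ : ℕ} (π : Equiv.Perm (Fin n)) {j : Fin n} (hj : τ ≤ (j : ℕ)) :
    rk τ π (π j) < n - τ := by
  rw [← card_ge (n := n) τ]
  unfold rk
  apply Finset.card_lt_card
  rw [Finset.ssubset_iff_of_subset]
  · exact ⟨j, by simp [hj], by simp⟩
  · intro x hx
    simp only [Finset.mem_filter, Finset.mem_univ, true_and] at hx ⊢
    exact hx.1

lemma rk_surj {n τ : ℕ} (π : Equiv.Perm (Fin n)) {r : ℕ} (hr : r < n - τ) :
    ∃ j : Fin n, τ ≤ (j : ℕ) ∧ rk τ π (π j) = r := by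
  have := Finset.surjOn_of_injOn_of_card_le (fun j => rk τ π (π j))
    (s := Finset.univ.filter (fun j : Fin n => τ ≤ (j : ℕ))) (t := Finset.range (n - τ))
    (by intro j hj
        simp only [Finset.coe_filter, Finset.mem_univ, true_and, Set.mem_ofPred_eq] at hj
        simpa using rk_lt π hj)
    (by intro j hj j' hj' h
        simp only [Finset.coe_filter, Finset.mem_univ, true_and, Set.mem_ofPred_eq] at hj hj'
        exact rk_inj π hj hj' h)
    (by rw [card_ge, Finset.card_range])
  obtain ⟨j, hj, h⟩ := this (by simpa using hr : r ∈ ((Finset.range (n - τ) : Finset ℕ) : Set ℕ))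
  simp only [Finset.coe_filter, Finset.mem_univ, true_and, Set.mem_ofPred_eq] at hj
  exact ⟨j, hj, h⟩

lemma invCount_eq_sum (n : ℕ) (π : Equiv.Perm (Fin n)) :
    invCount n π = ∑ i, (Finset.univ.filter (fun j => i < j ∧ π j < π i)).card := by
  unfold invCount
  simp only [Finset.card_filter]
  rw [← Finset.univ_product_univ, Finset.sum_product]

lemma invCount_swap {n : ℕ} (π : Equiv.Perm (Fin n)) (τ j : Fin n) (hj : τ < j)
    (hv : π τ < π j) (hcons : ∀ x, τ ≤ x → ¬ (π τ < π x ∧ π x < π j)) :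
    invCount n (π * Equiv.swap τ j) = invCount n π + 1 := by
  rw [invCount_eq_sum, invCount_eq_sum,
    ← Finset.add_sum_erase _ _ (Finset.mem_univ τ), ← Finset.add_sum_erase Finset.univ _ (Finset.mem_univ τ)]
  have hsw : ∀ x, x ≠ τ → x ≠ j → Equiv.swap τ j x = x := fun x h1 h2 =>
    Equiv.swap_apply_of_ne_of_ne h1 h2
  have key : (Finset.univ.filter (fun k => τ < k ∧ (π * Equiv.swap τ j) k < (π * Equiv.swap τ j) τ)).card
      = (Finset.univ.filter (fun k => τ < k ∧ π k < π τ)).card + 1 := by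
    have : Finset.univ.filter (fun k => τ < k ∧ (π * Equiv.swap τ j) k < (π * Equiv.swap τ j) τ)
        = insert j (Finset.univ.filter (fun k => τ < k ∧ π k < π τ)) := by
      ext x
      simp only [Finset.mem_filter, Finset.mem_univ, true_and, Finset.mem_insert,
        Equiv.Perm.mul_apply, Equiv.swap_apply_left]
      by_cases hx : x = j
      · subst hx; simp [hj, hv]
      · simp only [hx, false_or]
        refine and_congr_right fun h1 => ?_
        rw [hsw x h1.ne' hx]
        have h2 := hcons x h1.le
        have h3 : π x ≠ π τ := fun h => h1.ne' (π.injective h)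
        constructor
        · intro h4
          by_contra h5
          exact h2 ⟨lt_of_le_of_ne (not_lt.1 h5) h3.symm, h4⟩
        · intro h4; exact h4.trans hv
    rw [this, Finset.card_insert_of_notMem]
    simp only [Finset.mem_filter, Finset.mem_univ, true_and, not_and, not_lt]
    intro _; exact hv.le
  rw [key]
  have rest : ∀ i ∈ Finset.univ.erase τ,
      (Finset.univ.filter (fun k => i < k ∧ (π * Equiv.swap τ j) k < (π * Equiv.swap τ j) i)).card
      = (Finset.univ.filter (fun k => i < k ∧ π k < π i)).card := by
    intro i hi
    have hi : i ≠ τ := by simpa using hi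
    rcases lt_or_gt_of_ne hi with hlt | hgt
    · have hij : i ≠ j := (hlt.trans hj).ne
      refine Finset.card_bij' (fun k _ => Equiv.swap τ j k) (fun k _ => Equiv.swap τ j k) ?_ ?_ ?_ ?_
      · intro k hk
        simp only [Finset.mem_filter, Finset.mem_univ, true_and] at hk ⊢
        try simp only [Equiv.Perm.mul_apply] at hk ⊢
        rw [hsw i hi hij] at hk
        refine ⟨?_, hk.2⟩
        by_cases h1 : k = τ
        · subst h1; rw [Equiv.swap_apply_left]; exact hlt.trans hj
        by_cases h2 : k = j
        · subst h2; rw [Equiv.swap_apply_right]; exact hlt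
        rw [hsw k h1 h2]; exact hk.1
      · intro k hk
        simp only [Finset.mem_filter, Finset.mem_univ, true_and] at hk ⊢
        try simp only [Equiv.Perm.mul_apply] at hk ⊢
        rw [hsw i hi hij, Equiv.swap_apply_self]
        refine ⟨?_, hk.2⟩
        by_cases h1 : k = τ
        · subst h1; rw [Equiv.swap_apply_left]; exact hlt.trans hj
        by_cases h2 : k = j
        · subst h2; rw [Equiv.swap_apply_right]; exact hlt
        rw [hsw k h1 h2]; exact hk.1
      · intro k _; simp
      · intro k _; simp
    · congr 1
      ext k
      simp only [Finset.mem_filter, Finset.mem_univ, true_and]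
      simp only [Equiv.Perm.mul_apply]
      refine and_congr_right fun h1 => ?_
      have hk : k ≠ τ := (hgt.trans h1).ne'
      by_cases h2 : k = j
      · subst h2
        rw [Equiv.swap_apply_right, hsw i hi h1.ne]
        have h3 := hcons i hgt.le
        have h4 : π i ≠ π k := fun h => h1.ne (π.injective h)
        constructor
        · intro h5
          by_contra h6
          exact h3 ⟨h5, lt_of_le_of_ne (not_lt.1 h6) h4⟩
        · intro h5; exact hv.trans h5
      · rw [hsw k hk h2]
        by_cases h3 : i = j
        · subst h3
          rw [Equiv.swap_apply_right]
          have h3 := hcons k (hgt.trans h1).le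
          have h4 : π k ≠ π τ := fun h => hk (π.injective h)
          constructor
          · intro h5; exact h5.trans hv
          · intro h5
            by_contra h6
            exact h3 ⟨lt_of_le_of_ne (not_lt.1 h6) h4.symm, h5⟩
        · rw [hsw i hi h3]
  rw [Finset.sum_congr rfl rest]
  ring

/-- `q`-integer -/
def qn (q : ℝ) (m : ℕ) : ℝ := ∑ i ∈ Finset.range m, q ^ i

lemma fixB_swap {n : ℕ} (τ j : Fin n) (hj : τ ≤ j) : FixB (τ : ℕ) (Equiv.swap τ j) := by
  intro i hi
  apply Equiv.swap_apply_of_ne_of_ne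
  · rintro rfl; omega
  · rintro rfl; exact absurd hi (not_lt.2 hj)

/-- one-step comparison of code weights -/
lemma code_step {n : ℕ} (q : ℝ) (τ : Fin n) (F : Equiv.Perm (Fin n) → ℝ) (hF : RInv (τ : ℕ) F)
    (r : ℕ) (hr : r + 1 < n - (τ : ℕ)) :
    ∑ π ∈ Finset.univ.filter (fun π : Equiv.Perm (Fin n) => rk τ π (π τ) = r + 1),
      q ^ invCount n π * F π
    = q * ∑ π ∈ Finset.univ.filter (fun π : Equiv.Perm (Fin n) => rk τ π (π τ) = r),
      q ^ invCount n π * F π := by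
  have hex : ∀ (k : ℕ), k < n - (τ : ℕ) → ∀ π : Equiv.Perm (Fin n), ∃ j : Fin n,
      (τ : ℕ) ≤ (j : ℕ) ∧ rk τ π (π j) = k := fun k hk π => rk_surj π hk
  choose a ha1 ha2 using hex (r + 1) hr
  choose b hb1 hb2 using hex r (by omega)
  rw [Finset.mul_sum]
  symm
  have main : ∀ π : Equiv.Perm (Fin n), rk τ π (π τ) = r →
      rk τ (π * Equiv.swap τ (a π)) ((π * Equiv.swap τ (a π)) τ) = r + 1 := by
    intro π hπ
    rw [rk_mul_right _ _ (fixB_swap τ _ (ha1 π)), Equiv.Perm.mul_apply, Equiv.swap_apply_left, ha2]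
  have main' : ∀ π : Equiv.Perm (Fin n), rk τ π (π τ) = r + 1 →
      rk τ (π * Equiv.swap τ (b π)) ((π * Equiv.swap τ (b π)) τ) = r := by
    intro π hπ
    rw [rk_mul_right _ _ (fixB_swap τ _ (hb1 π)), Equiv.Perm.mul_apply, Equiv.swap_apply_left, hb2]
  refine Finset.sum_bij' (fun π _ => π * Equiv.swap τ (a π)) (fun π _ => π * Equiv.swap τ (b π))
    ?_ ?_ ?_ ?_ ?_
  · intro π hπ
    rw [Finset.mem_filter] at hπ ⊢
    exact ⟨Finset.mem_univ _, main π hπ.2⟩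
  · intro π hπ
    rw [Finset.mem_filter] at hπ ⊢
    exact ⟨Finset.mem_univ _, main' π hπ.2⟩
  · intro π hπ
    rw [Finset.mem_filter] at hπ
    have hfix := fixB_swap τ _ (ha1 π)
    have : b (π * Equiv.swap τ (a π)) = a π := by
      apply rk_inj (τ := τ) (π * Equiv.swap τ (a π)) (hb1 _) (ha1 _)
      rw [hb2, rk_mul_right _ _ hfix, Equiv.Perm.mul_apply, Equiv.swap_apply_right, hπ.2]
    rw [this, mul_assoc, Equiv.swap_mul_self, mul_one]
  · intro π hπ
    rw [Finset.mem_filter] at hπ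
    have hfix := fixB_swap τ _ (hb1 π)
    have : a (π * Equiv.swap τ (b π)) = b π := by
      apply rk_inj (τ := τ) (π * Equiv.swap τ (b π)) (ha1 _) (hb1 _)
      rw [ha2, rk_mul_right _ _ hfix, Equiv.Perm.mul_apply, Equiv.swap_apply_right, hπ.2]
    rw [this, mul_assoc, Equiv.swap_mul_self, mul_one]
  · intro π hπ
    rw [Finset.mem_filter] at hπ
    rw [hF _ _ (fixB_swap τ _ (ha1 π))]
    have hne : a π ≠ τ := by
      intro h
      have := ha2 π
      rw [h, hπ.2] at this
      omega
    have hlt : τ < a π := lt_of_le_of_ne (ha1 π) hne.symm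
    have hv : π τ < π (a π) := by
      by_contra h
      have h1 : π (a π) < π τ :=
        lt_of_le_of_ne (not_lt.1 h) (fun h => hne (π.injective h))
      have := rk_strict (τ := τ) π (ha1 π) h1
      rw [hπ.2, ha2] at this
      omega
    rw [invCount_swap π τ (a π) hlt hv]
    · ring
    · rintro x hx ⟨h1, h2⟩
      have h3 := rk_strict (τ := τ) π le_rfl h1
      have h4 := rk_strict (τ := τ) π (show (τ : ℕ) ≤ (x : ℕ) from hx) h2
      rw [hπ.2] at h3
      rw [ha2] at h4
      omega

lemma code_pow {n : ℕ} (q : ℝ) (τ : Fin n) (F : Equiv.Perm (Fin n) → ℝ) (hF : RInv (τ : ℕ) F)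
    (r : ℕ) (hr : r < n - (τ : ℕ)) :
    ∑ π ∈ Finset.univ.filter (fun π : Equiv.Perm (Fin n) => rk τ π (π τ) = r),
      q ^ invCount n π * F π
    = q ^ r * ∑ π ∈ Finset.univ.filter (fun π : Equiv.Perm (Fin n) => rk τ π (π τ) = 0),
      q ^ invCount n π * F π := by
  induction r with
  | zero => simp
  | succ r ih => rw [code_step q τ F hF r hr, ih (by omega)]; ring

lemma sum_code {n : ℕ} (τ : Fin n) (X : Equiv.Perm (Fin n) → ℝ) :
    ∑ π, X π = ∑ r ∈ Finset.range (n - (τ : ℕ)),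
      ∑ π ∈ Finset.univ.filter (fun π : Equiv.Perm (Fin n) => rk τ π (π τ) = r), X π := by
  rw [Finset.sum_fiberwise_of_maps_to (g := fun π : Equiv.Perm (Fin n) => rk τ π (π τ))]
  intro π _
  simpa using rk_lt (τ := τ) π le_rfl

lemma code_total {n : ℕ} (q : ℝ) (τ : Fin n) (F : Equiv.Perm (Fin n) → ℝ) (hF : RInv (τ : ℕ) F) :
    ∑ π, q ^ invCount n π * F π
    = qn q (n - (τ : ℕ)) *
      ∑ π ∈ Finset.univ.filter (fun π : Equiv.Perm (Fin n) => rk τ π (π τ) = 0),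
      q ^ invCount n π * F π := by
  rw [sum_code τ, qn, Finset.sum_mul]
  exact Finset.sum_congr rfl fun r hr => code_pow q τ F hF r (by simpa using hr)

lemma qn_pos {q : ℝ} (hq : 0 < q) {m : ℕ} (hm : 0 < m) : 0 < qn q m :=
  Finset.sum_pos (fun _ _ => pow_pos hq _) ⟨0, by simpa using hm⟩

lemma code_law {n : ℕ} {q : ℝ} (hq : 0 < q) (τ : Fin n) (F : Equiv.Perm (Fin n) → ℝ)
    (hF : RInv (τ : ℕ) F) (r : ℕ) (hr : r < n - (τ : ℕ)) :
    ∑ π ∈ Finset.univ.filter (fun π : Equiv.Perm (Fin n) => rk τ π (π τ) = r),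
      q ^ invCount n π * F π
    = q ^ r / qn q (n - (τ : ℕ)) * ∑ π, q ^ invCount n π * F π := by
  rw [code_pow q τ F hF r hr, code_total q τ F hF]
  have := (qn_pos hq (m := n - (τ : ℕ)) (by omega)).ne'
  field_simp

/-- Kernel lemma -/
lemma kernel {n : ℕ} {q : ℝ} (hq : 0 < q) (τ : Fin n) (f : Equiv.Perm (Fin n) → Fin n → ℝ)
    (hf : ∀ v, RInv (τ : ℕ) (fun π => f π v)) :
    mExp n q (fun π => f π (π τ)) = mExp n q (fun π =>
      ∑ v ∈ Finset.univ.filter (fun v => (τ : ℕ) ≤ ((π⁻¹ v : Fin n) : ℕ)),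
        q ^ rk τ π v / qn q (n - (τ : ℕ)) * f π v) := by
  set F : ℕ → Equiv.Perm (Fin n) → ℝ := fun r π =>
    ∑ v ∈ Finset.univ.filter (fun v => (τ : ℕ) ≤ ((π⁻¹ v : Fin n) : ℕ)),
      if rk τ π v = r then f π v else 0 with hFdef
  have hset : ∀ (π h : Equiv.Perm (Fin n)), FixB (τ : ℕ) h → ∀ v,
      ((τ : ℕ) ≤ (((π * h)⁻¹ v : Fin n) : ℕ) ↔ (τ : ℕ) ≤ ((π⁻¹ v : Fin n) : ℕ)) := by
    intro π h hh v
    rw [mul_inv_rev, Equiv.Perm.mul_apply]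
    have := hh.inv.lt_iff (π⁻¹ v)
    omega
  have hF : ∀ r, RInv (τ : ℕ) (F r) := by
    intro r π h hh
    simp only [hFdef]
    apply Finset.sum_congr
    · ext v; simp only [Finset.mem_filter, Finset.mem_univ, true_and]; exact hset π h hh v
    · intro v _
      rw [rk_mul_right _ _ hh]
      have := hf v π h hh
      dsimp only at this
      rw [this]
  have hFv : ∀ π : Equiv.Perm (Fin n), F (rk τ π (π τ)) π = f π (π τ) := by
    intro π
    simp only [hFdef]
    rw [Finset.sum_eq_single (π τ)]
    · simp
    · intro v hv hne
      rw [Finset.mem_filter] at hv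
      rw [if_neg]
      intro h
      apply hne
      have h1 : π (π⁻¹ v) = v := by simp
      rw [← h1] at h
      have := rk_inj (τ := τ) π hv.2 le_rfl h
      rw [← this, h1]
    · intro h; exfalso; apply h; simp
  have hL : ∑ π : Equiv.Perm (Fin n), q ^ invCount n π * f π (π τ)
      = ∑ π : Equiv.Perm (Fin n), q ^ invCount n π * ∑ r ∈ Finset.range (n - (τ : ℕ)),
          q ^ r / qn q (n - (τ : ℕ)) * F r π := by
    rw [sum_code τ]
    simp only [Finset.mul_sum]
    rw [Finset.sum_comm]
    apply Finset.sum_congr rfl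
    intro r hr
    rw [Finset.mem_range] at hr
    have h1 := code_law hq τ (F r) (hF r) r hr
    calc _ = ∑ π ∈ Finset.univ.filter (fun π : Equiv.Perm (Fin n) => rk τ π (π τ) = r),
          q ^ invCount n π * F r π := by
          apply Finset.sum_congr rfl
          intro π hπ
          rw [Finset.mem_filter] at hπ
          rw [← hFv π, hπ.2]
      _ = _ := by
          rw [h1, Finset.mul_sum]
          exact Finset.sum_congr rfl fun π _ => by ring
  have hR : ∀ π : Equiv.Perm (Fin n), ∑ r ∈ Finset.range (n - (τ : ℕ)),
          q ^ r / qn q (n - (τ : ℕ)) * F r π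
      = ∑ v ∈ Finset.univ.filter (fun v => (τ : ℕ) ≤ ((π⁻¹ v : Fin n) : ℕ)),
        q ^ rk τ π v / qn q (n - (τ : ℕ)) * f π v := by
    intro π
    simp only [hFdef, Finset.mul_sum]
    rw [Finset.sum_comm]
    apply Finset.sum_congr rfl
    intro v hv
    rw [Finset.mem_filter] at hv
    rw [Finset.sum_eq_single (rk τ π v)]
    · simp
    · intro r _ hne; rw [if_neg (Ne.symm hne), mul_zero]
    · intro h
      exfalso; apply h
      have := rk_lt (τ := τ) π hv.2
      simpa using this
  have hdiv : ∀ X : Equiv.Perm (Fin n) → ℝ,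
      mExp n q X = (∑ π, q ^ invCount n π * X π) / mallowsZ n q := by
    intro X
    unfold mExp mallowsP
    rw [Finset.sum_div]
    exact Finset.sum_congr rfl fun π _ => by ring
  rw [hdiv, hdiv, hL]
  congr 1
  exact Finset.sum_congr rfl fun π _ => by rw [hR π]

/-- point masses -/
lemma kernel_point {n : ℕ} {q : ℝ} (hq : 0 < q) (τ : Fin n) (G : Equiv.Perm (Fin n) → ℝ)
    (x : Equiv.Perm (Fin n) → Fin n) (hG : RInv (τ : ℕ) G) (hx : RInv (τ : ℕ) x)
    (hGx : ∀ π, G π ≠ 0 → (τ : ℕ) ≤ ((π⁻¹ (x π) : Fin n) : ℕ)) :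
    mExp n q (fun π => G π * ind (π τ = x π))
      = mExp n q (fun π => G π * (q ^ rk τ π (x π) / qn q (n - (τ : ℕ)))) := by
  have := kernel hq τ (fun π v => G π * ind (v = x π)) (by
    intro v π h hh
    dsimp only
    rw [hG π h hh, hx π h hh])
  rw [this]
  apply mExp_congr
  intro π
  by_cases h0 : G π = 0
  · simp [h0]
  rw [Finset.sum_eq_single (x π)]
  · rw [ind_true rfl]; ring
  · intro v _ hne; rw [ind_false hne]; ring
  · intro h; exfalso; apply h; simpa using hGx π h0

/-- tails -/
lemma kernel_tail {n : ℕ} {q : ℝ} (hq : 0 < q) (τ : Fin n) (G : Equiv.Perm (Fin n) → ℝ)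
    (k : Equiv.Perm (Fin n) → ℕ) (hG : RInv (τ : ℕ) G) (hk : RInv (τ : ℕ) k)
    (hG0 : ∀ π, 0 ≤ G π) :
    mExp n q (fun π => G π * ind (k π ≤ rk τ π (π τ)))
      ≤ mExp n q (fun π => G π * q ^ k π) := by
  have := kernel hq τ (fun π v => G π * ind (k π ≤ rk τ π v)) (by
    intro v π h hh
    dsimp only
    rw [hG π h hh, hk π h hh, rk_mul_right _ _ hh])
  rw [this]
  apply mExp_mono hq
  intro π
  have hm := qn_pos hq (m := n - (τ : ℕ)) (by omega)
  calc _ = G π / qn q (n - (τ : ℕ)) *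
        ∑ v ∈ Finset.univ.filter (fun v => (τ : ℕ) ≤ ((π⁻¹ v : Fin n) : ℕ)),
          q ^ rk τ π v * ind (k π ≤ rk τ π v) := by
          rw [Finset.mul_sum]
          exact Finset.sum_congr rfl fun v _ => by ring
    _ = G π / qn q (n - (τ : ℕ)) *
        ∑ r ∈ (Finset.univ.filter (fun v => (τ : ℕ) ≤ ((π⁻¹ v : Fin n) : ℕ))).image (rk τ π),
          q ^ r * ind (k π ≤ r) := by
          rw [Finset.sum_image]
          intro v hv v' hv' h
          simp only [Finset.coe_filter, Finset.mem_univ, true_and, Set.mem_ofPred_eq] at hv hv'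
          have h1 : π (π⁻¹ v) = v := by simp
          have h2 : π (π⁻¹ v') = v' := by simp
          rw [← h1, ← h2] at h
          have := rk_inj (τ := τ) π hv hv' h
          rw [← h1, this, h2]
    _ ≤ G π / qn q (n - (τ : ℕ)) * ∑ r ∈ Finset.range (n - (τ : ℕ)), q ^ r * ind (k π ≤ r) := by
          apply mul_le_mul_of_nonneg_left _ (div_nonneg (hG0 π) hm.le)
          apply Finset.sum_le_sum_of_subset_of_nonneg
          · intro r hr
            rw [Finset.mem_image] at hr
            obtain ⟨v, hv, rfl⟩ := hr
            rw [Finset.mem_filter] at hv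
            have := rk_lt (τ := τ) π hv.2
            simpa using this
          · intro r _ _; exact mul_nonneg (pow_pos hq _).le (ind_nonneg _)
    _ ≤ G π / qn q (n - (τ : ℕ)) * (q ^ k π * qn q (n - (τ : ℕ))) := by
          apply mul_le_mul_of_nonneg_left _ (div_nonneg (hG0 π) hm.le)
          have e : ∑ r ∈ Finset.range (n - (τ : ℕ)), q ^ r * ind (k π ≤ r)
              = ∑ r ∈ (Finset.range (n - (τ : ℕ))).filter (fun r => k π ≤ r), q ^ r := by
            rw [Finset.sum_filter]
            exact Finset.sum_congr rfl fun r _ => by unfold ind; split_ifs <;> simp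
          rw [e, qn, Finset.mul_sum]
          calc _ = ∑ i ∈ ((Finset.range (n - (τ : ℕ))).filter (fun r => k π ≤ r)).image
                (fun r => r - k π), q ^ k π * q ^ i := by
                rw [Finset.sum_image]
                · apply Finset.sum_congr rfl
                  intro r hr
                  rw [Finset.mem_filter] at hr
                  rw [← pow_add]; congr 1; omega
                · intro a ha b hb h
                  simp only [Finset.coe_filter, Set.mem_ofPred_eq] at ha hb
                  dsimp only at h
                  omega
            _ ≤ _ := by
                apply Finset.sum_le_sum_of_subset_of_nonneg
                · intro i hi
                  simp only [Finset.mem_image, Finset.mem_filter, Finset.mem_range] at hi ⊢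
                  omega
                · intro i _ _; positivity
    _ = _ := by field_simp

/-! ### The number of open arcs -/

def kap {n : ℕ} (τ : ℕ) (π : Equiv.Perm (Fin n)) : ℕ :=
  (Finset.univ.filter (fun j : Fin n => τ ≤ (j : ℕ) ∧ ((π j : Fin n) : ℕ) < τ)).card

lemma card_eq_sum_ind {n : ℕ} (P : Fin n → Prop) [DecidablePred P] :
    ((Finset.univ.filter P).card : ℝ) = ∑ j, ind (P j) := by
  rw [Finset.card_filter]; push_cast
  apply Finset.sum_congr rfl
  intro j _
  by_cases h : P j <;> simp [ind, h]

lemma kap_eq {n : ℕ} (τ : ℕ) (π : Equiv.Perm (Fin n)) :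
    (kap τ π : ℝ) = ∑ j : Fin n, ind (τ ≤ (j : ℕ) ∧ ((π j : Fin n) : ℕ) < τ) :=
  card_eq_sum_ind _

lemma kap_eq' {n : ℕ} (τ : ℕ) (π : Equiv.Perm (Fin n)) :
    (kap τ π : ℝ) = ∑ j : Fin n, ind ((j : ℕ) < τ ∧ τ ≤ ((π j : Fin n) : ℕ)) := by
  rw [kap_eq]
  have h1 : ∑ j : Fin n, ind (τ ≤ ((π j : Fin n) : ℕ)) = ∑ j : Fin n, ind (τ ≤ (j : ℕ)) :=
    Equiv.sum_comp π (fun j : Fin n => ind (τ ≤ (j : ℕ)))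
  have h2 : ∀ j : Fin n, ind (τ ≤ (j : ℕ) ∧ ((π j : Fin n) : ℕ) < τ) =
      ind ((j : ℕ) < τ ∧ τ ≤ ((π j : Fin n) : ℕ)) + (ind (τ ≤ (j : ℕ)) -
      ind (τ ≤ ((π j : Fin n) : ℕ))) := by
    intro j
    by_cases a : τ ≤ (j : ℕ) <;> by_cases b : τ ≤ ((π j : Fin n) : ℕ) <;>
      simp [ind, a, b, not_le.1, not_lt.2]
  rw [Finset.sum_congr rfl (fun j _ => h2 j), Finset.sum_add_distrib, Finset.sum_sub_distrib, h1]
  ring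

lemma kap_inv {n : ℕ} (τ : ℕ) (π : Equiv.Perm (Fin n)) : kap τ π⁻¹ = kap τ π := by
  have : (kap τ π⁻¹ : ℝ) = kap τ π := by
    rw [kap_eq, kap_eq', ← Equiv.sum_comp π]
    apply Finset.sum_congr rfl
    intro j _
    simp [and_comm]
  exact_mod_cast this

lemma kap_LInv {n : ℕ} (τ : ℕ) : LInv τ (fun π : Equiv.Perm (Fin n) => kap τ π) := by
  intro π h hh
  unfold kap
  refine congrArg Finset.card (Finset.filter_congr fun j _ => ?_)
  rw [Equiv.Perm.mul_apply, hh.lt_iff]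

lemma kap_RInv {n : ℕ} (τ : ℕ) : RInv τ (fun π : Equiv.Perm (Fin n) => kap τ π) := by
  have := (kap_LInv (n := n) τ).inv
  simpa only [kap_inv] using this

lemma kap_succ {n : ℕ} (τ : Fin n) (π : Equiv.Perm (Fin n)) :
    (kap ((τ : ℕ) + 1) π : ℝ) = kap (τ : ℕ) π - ind (((π τ : Fin n) : ℕ) < τ)
      + ind ((τ : ℕ) < ((π⁻¹ τ : Fin n) : ℕ)) := by
  rw [kap_eq, kap_eq]
  have h1 : ind (((π τ : Fin n) : ℕ) < τ)
      = ∑ j : Fin n, if j = τ then ind (((π j : Fin n) : ℕ) < τ) else 0 := by simp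
  have h2 : ind ((τ : ℕ) < ((π⁻¹ τ : Fin n) : ℕ))
      = ∑ j : Fin n, if j = π⁻¹ τ then ind ((τ : ℕ) < (j : ℕ)) else 0 := by simp
  rw [h1, h2, ← Finset.sum_sub_distrib, ← Finset.sum_add_distrib]
  apply Finset.sum_congr rfl
  intro j _
  have e1 : j = τ ↔ (j : ℕ) = (τ : ℕ) := Fin.ext_iff
  have e2 : j = π⁻¹ τ ↔ ((π j : Fin n) : ℕ) = (τ : ℕ) := by
    rw [← Fin.ext_iff, Equiv.Perm.eq_inv_iff_eq]
  simp only [e1, e2, ind]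
  split_ifs <;> first | (exfalso; omega) | norm_num

lemma kap_le_rk {n : ℕ} (τ : ℕ) (π : Equiv.Perm (Fin n)) (v : Fin n) (h : τ ≤ (v : ℕ)) :
    kap τ π ≤ rk τ π v := by
  unfold kap rk
  apply Finset.card_le_card
  intro j hj
  simp only [Finset.mem_filter, Finset.mem_univ, true_and] at hj ⊢
  exact ⟨hj.1, Fin.lt_def.2 (by omega)⟩

lemma rk_le_kap {n : ℕ} (τ : ℕ) (π : Equiv.Perm (Fin n)) (v : Fin n) (h : (v : ℕ) ≤ τ) :
    rk τ π v ≤ kap τ π := by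
  unfold kap rk
  apply Finset.card_le_card
  intro j hj
  simp only [Finset.mem_filter, Finset.mem_univ, true_and, Fin.lt_def] at hj ⊢
  exact ⟨hj.1, by omega⟩

lemma up_bound {n : ℕ} {q : ℝ} (hq : 0 < q) (τ : Fin n) (G : Equiv.Perm (Fin n) → ℝ)
    (hG : RInv (τ : ℕ) G) (hG0 : ∀ π, 0 ≤ G π) :
    mExp n q (fun π => G π * ind ((τ : ℕ) ≤ ((π τ : Fin n) : ℕ)))
      ≤ mExp n q (fun π => G π * q ^ kap (τ : ℕ) π) := by
  refine le_trans (mExp_mono hq fun π => ?_)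
    (kernel_tail hq τ G (fun π => kap (τ : ℕ) π) hG (kap_RInv _) hG0)
  exact mul_le_mul_of_nonneg_left (ind_mono (kap_le_rk _ _ _)) (hG0 π)

lemma drift {n : ℕ} {q : ℝ} (hq : 0 < q) (τ : Fin n) (G : Equiv.Perm (Fin n) → ℝ)
    (hR : RInv (τ : ℕ) G) (hL : LInv (τ : ℕ) G) (hG0 : ∀ π, 0 ≤ G π) :
    mExp n q (fun π => G π * kap ((τ : ℕ) + 1) π)
      ≤ mExp n q (fun π => G π * kap (τ : ℕ) π)
        + mExp n q (fun π => G π * (2 * q ^ kap (τ : ℕ) π - 1)) := by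
  have h1 := up_bound hq τ G hR hG0
  have h2 := up_bound hq τ (fun π => G π⁻¹) hL.inv (fun π => hG0 _)
  rw [← mExp_inv (fun π => G π * q ^ kap (τ : ℕ) π)] at h1
  rw [← mExp_inv] at h2
  simp only [inv_inv, kap_inv] at h1 h2
  rw [← mExp_inv (fun π => G π⁻¹ * q ^ kap (τ : ℕ) π), ] at h1
  simp only [inv_inv, kap_inv] at h1
  rw [← mExp_inv (fun π => G π⁻¹ * q ^ kap (τ : ℕ) π)] at h2
  simp only [inv_inv, kap_inv] at h2
  calc _ ≤ mExp n q (fun π => (G π * kap (τ : ℕ) π + (G π * ind ((τ : ℕ) ≤ ((π τ : Fin n) : ℕ))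
          + G π * ind ((τ : ℕ) ≤ ((π⁻¹ τ : Fin n) : ℕ)))) - G π) := by
        apply mExp_mono hq
        intro π
        rw [kap_succ]
        have e1 : ind ((τ : ℕ) < ((π⁻¹ τ : Fin n) : ℕ)) ≤ ind ((τ : ℕ) ≤ ((π⁻¹ τ : Fin n) : ℕ)) :=
          ind_mono le_of_lt
        have e2 : ind (((π τ : Fin n) : ℕ) < τ) = 1 - ind ((τ : ℕ) ≤ ((π τ : Fin n) : ℕ)) := by
          unfold ind; split_ifs <;> first | (exfalso; omega) | norm_num
        rw [e2]
        nlinarith [hG0 π, mul_le_mul_of_nonneg_left e1 (hG0 π)]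
    _ = mExp n q (fun π => G π * kap (τ : ℕ) π) +
          (mExp n q (fun π => G π * ind ((τ : ℕ) ≤ ((π τ : Fin n) : ℕ)))
          + mExp n q (fun π => G π * ind ((τ : ℕ) ≤ ((π⁻¹ τ : Fin n) : ℕ)))) - mExp n q G := by
        rw [mExp_sub, mExp_add, mExp_add]
    _ ≤ mExp n q (fun π => G π * kap (τ : ℕ) π) +
          (mExp n q (fun π => G π * q ^ kap (τ : ℕ) π)
          + mExp n q (fun π => G π * q ^ kap (τ : ℕ) π)) - mExp n q G := by
        linarith
    _ = _ := by
        have : mExp n q (fun π => G π * (2 * q ^ kap (τ : ℕ) π - 1))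
          = 2 * mExp n q (fun π => G π * q ^ kap (τ : ℕ) π) - mExp n q G := by
          rw [← mExp_smul, ← mExp_sub]
          exact mExp_congr fun π => by ring
        rw [this]; ring

lemma qn_le {q : ℝ} (hq : 0 < q) (hq1 : q < 1) (m : ℕ) : qn q m ≤ 1 / (1 - q) := by
  have h := geom_sum_mul q m
  have : 0 < 1 - q := by linarith
  rw [le_div_iff₀ this]
  unfold qn
  nlinarith [pow_pos hq m]

lemma rk_self_ge {n : ℕ} (π : Equiv.Perm (Fin n)) (i : Fin n) :
    ((π i : Fin n) : ℕ) - (i : ℕ) ≤ rk (i : ℕ) π (π i) := by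
  have h1 : (Finset.univ.filter (fun j : Fin n => π j < π i)).card = ((π i : Fin n) : ℕ) := by
    rw [← Fin.card_Iio (π i)]
    refine Finset.card_bij' (fun j _ => π j) (fun j _ => π⁻¹ j) ?_ ?_ ?_ ?_ <;> simp
  have h2 : (Finset.univ.filter (fun j : Fin n => π j < π i)) ⊆
      (Finset.univ.filter (fun j : Fin n => (i : ℕ) ≤ (j : ℕ) ∧ π j < π i)) ∪ Finset.Iio i := by
    intro j hj
    simp only [Finset.mem_union, Finset.mem_filter, Finset.mem_univ, true_and, Finset.mem_Iio,
      Fin.lt_def] at hj ⊢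
    omega
  have h3 := (Finset.card_le_card h2).trans (Finset.card_union_le _ _)
  rw [h1, Fin.card_Iio] at h3
  unfold rk
  omega

lemma mExp_kap_le {n : ℕ} {q : ℝ} (hq : 0 < q) (hq1 : q < 1) (τ : ℕ) :
    mExp n q (fun π => (kap τ π : ℝ)) ≤ 1 / (1 - q) := by
  have h0 : mExp n q (fun π => (kap τ π : ℝ))
      = ∑ i : Fin n, mExp n q (fun π => ind ((i : ℕ) < τ ∧ τ ≤ ((π i : Fin n) : ℕ))) := by
    rw [← mExp_sum]
    exact mExp_congr fun π => kap_eq' τ π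
  rw [h0]
  have h1 : ∀ i : Fin n, mExp n q (fun π => ind ((i : ℕ) < τ ∧ τ ≤ ((π i : Fin n) : ℕ)))
      ≤ if (i : ℕ) < τ then q ^ (τ - (i : ℕ)) else 0 := by
    intro i
    split_ifs with hi
    · have := kernel_tail hq i (fun _ => 1) (fun _ => τ - (i : ℕ)) (fun _ _ _ => rfl)
        (fun _ _ _ => rfl) (fun _ => zero_le_one)
      simp only [one_mul] at this
      rw [mExp_const hq] at this
      refine le_trans (mExp_mono hq fun π => ind_mono ?_) this
      rintro ⟨_, h⟩
      have := rk_self_ge π i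
      omega
    · apply le_of_eq
      rw [← mExp_const (n := n) hq 0]
      exact mExp_congr fun π => ind_false (fun h => hi h.1)
  refine (Finset.sum_le_sum fun i _ => h1 i).trans ?_
  rw [← Finset.sum_filter]
  refine le_trans ?_ (qn_le hq hq1 (τ + 1))
  unfold qn
  rw [← Finset.sum_image (s := Finset.univ.filter (fun i : Fin n => (i : ℕ) < τ))
    (g := fun i : Fin n => τ - (i : ℕ)) (f := fun d => q ^ d)]
  · apply Finset.sum_le_sum_of_subset_of_nonneg
    · intro d hd
      simp only [Finset.mem_image, Finset.mem_range] at hd ⊢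
      obtain ⟨a, _, rfl⟩ := hd
      omega
    · intro i _ _; positivity
  · intro a ha b hb h
    simp only [Finset.coe_filter, Finset.mem_univ, true_and, Set.mem_ofPred_eq] at ha hb
    dsimp only at h
    exact Fin.ext (by omega)

/-! ### Ends of open paths -/

def gstep {n : ℕ} (τ : ℕ) (π : Equiv.Perm (Fin n)) (x : Fin n) : Fin n :=
  if ((π x : Fin n) : ℕ) < τ then π x else x

def eend {n : ℕ} (τ : ℕ) (π : Equiv.Perm (Fin n)) (x : Fin n) : Fin n := (gstep τ π)^[n] x

def Op {n : ℕ} (τ : ℕ) (π : Equiv.Perm (Fin n)) (s : Fin n) : Prop :=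
  ∃ y, π.SameCycle s y ∧ τ ≤ (y : ℕ)

lemma iter_lt {n τ : ℕ} (π : Equiv.Perm (Fin n)) (x : Fin n) (hx : (x : ℕ) < τ) (k : ℕ) :
    (((gstep τ π)^[k] x : Fin n) : ℕ) < τ := by
  induction k with
  | zero => simpa
  | succ k ih =>
    rw [Function.iterate_succ_apply']
    generalize (gstep τ π)^[k] x = y at ih
    unfold gstep
    split_ifs with h
    · exact h
    · exact ih

lemma eend_lt {n τ : ℕ} (π : Equiv.Perm (Fin n)) (x : Fin n) (hx : (x : ℕ) < τ) :
    ((eend τ π x : Fin n) : ℕ) < τ := iter_lt π x hx n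

lemma iter_sameCycle {n τ : ℕ} (π : Equiv.Perm (Fin n)) (x : Fin n) (k : ℕ) :
    π.SameCycle x ((gstep τ π)^[k] x) := by
  induction k with
  | zero => exact Equiv.Perm.SameCycle.refl _ _
  | succ k ih =>
    rw [Function.iterate_succ_apply']
    generalize (gstep τ π)^[k] x = y at ih
    unfold gstep
    split_ifs with h
    · exact Equiv.Perm.sameCycle_apply_right.2 ih
    · exact ih

lemma eend_sameCycle {n τ : ℕ} (π : Equiv.Perm (Fin n)) (x : Fin n) :
    π.SameCycle x (eend τ π x) := iter_sameCycle π x n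

lemma iter_mul_right {n τ : ℕ} (π h : Equiv.Perm (Fin n)) (hh : FixB τ h) (x : Fin n)
    (hx : (x : ℕ) < τ) (k : ℕ) : (gstep τ (π * h))^[k] x = (gstep τ π)^[k] x := by
  induction k with
  | zero => rfl
  | succ k ih =>
    rw [Function.iterate_succ_apply', Function.iterate_succ_apply', ih]
    have := iter_lt π x hx k
    generalize (gstep τ π)^[k] x = y at this
    unfold gstep
    rw [Equiv.Perm.mul_apply, hh y this]

lemma iter_mul_left {n τ : ℕ} (π h : Equiv.Perm (Fin n)) (hh : FixB τ h) (x : Fin n)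
    (k : ℕ) : (gstep τ (h * π))^[k] x = (gstep τ π)^[k] x := by
  induction k with
  | zero => rfl
  | succ k ih =>
    rw [Function.iterate_succ_apply', Function.iterate_succ_apply', ih]
    generalize (gstep τ π)^[k] x = y
    unfold gstep
    rw [Equiv.Perm.mul_apply]
    by_cases h1 : ((π y : Fin n) : ℕ) < τ
    · rw [if_pos h1, if_pos ((hh.lt_iff _).2 h1), hh _ h1]
    · rw [if_neg h1, if_neg (fun h2 => h1 ((hh.lt_iff _).1 h2))]

lemma eend_RInv {n τ : ℕ} (x : Fin n) (hx : (x : ℕ) < τ) : RInv τ (fun π => eend τ π x) :=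
  fun π h hh => iter_mul_right π h hh x hx n

lemma eend_LInv {n τ : ℕ} (x : Fin n) : LInv τ (fun π => eend τ π x) :=
  fun π h hh => iter_mul_left π h hh x n

lemma bend_RInv {n τ : ℕ} (x : Fin n) : RInv τ (fun π => eend τ π⁻¹ x) := (eend_LInv x).inv
lemma bend_LInv {n τ : ℕ} (x : Fin n) (hx : (x : ℕ) < τ) : LInv τ (fun π => eend τ π⁻¹ x) :=
  (eend_RInv x hx).inv

lemma iter_stuck {n τ : ℕ} (π : Equiv.Perm (Fin n)) (x : Fin n) {k : ℕ}
    (h : τ ≤ ((π ((gstep τ π)^[k] x) : Fin n) : ℕ)) (l : ℕ) :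
    (gstep τ π)^[k + l] x = (gstep τ π)^[k] x := by
  induction l with
  | zero => rfl
  | succ l ih =>
    rw [← add_assoc, Function.iterate_succ_apply', ih]
    unfold gstep at h ⊢
    rw [if_neg (not_lt.2 h)]

lemma op_eend {n τ : ℕ} (π : Equiv.Perm (Fin n)) (x : Fin n) (h : Op τ π x) :
    τ ≤ ((π (eend τ π x) : Fin n) : ℕ) := by
  by_contra hc
  have hns : ∀ k ≤ n, ((π ((gstep τ π)^[k] x) : Fin n) : ℕ) < τ := by
    intro k hk
    by_contra hk2
    have := iter_stuck π x (not_lt.1 hk2) (n - k)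
    rw [Nat.add_sub_cancel' hk] at this
    unfold eend at hc
    rw [this] at hc
    exact hk2 (not_le.1 hc)
  have hpow : ∀ k ≤ n, (gstep τ π)^[k] x = (π ^ k) x := by
    intro k
    induction k with
    | zero => intro _; rfl
    | succ k ih =>
      intro hk
      have h1 := hns k (by omega)
      rw [Function.iterate_succ_apply', pow_succ', Equiv.Perm.mul_apply, ← ih (by omega)]
      conv_lhs => unfold gstep
      unfold gstep at h1
      rw [if_pos h1]
      rfl
  obtain ⟨y, hy, hτ⟩ := h
  obtain ⟨i, hi0, hi, hiy⟩ := hy.exists_pow_eq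
  have hcard : (π.cycleOf x).support.card ≤ n := by
    simpa using Finset.card_le_univ (π.cycleOf x).support
  obtain ⟨k, rfl⟩ : ∃ k, i = k + 1 := ⟨i - 1, by omega⟩
  have h1 := hns k (by omega)
  rw [hpow k (by omega)] at h1
  rw [pow_succ', Equiv.Perm.mul_apply] at hiy
  rw [hiy] at h1
  omega

lemma op_iff {n τ : ℕ} (π : Equiv.Perm (Fin n)) (x : Fin n) :
    Op τ π x ↔ τ ≤ ((π (eend τ π x) : Fin n) : ℕ) :=
  ⟨op_eend π x, fun h => ⟨_, Equiv.Perm.sameCycle_apply_right.2 (eend_sameCycle π x), h⟩⟩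

lemma op_inv {n τ : ℕ} (π : Equiv.Perm (Fin n)) (x : Fin n) : Op τ π⁻¹ x ↔ Op τ π x := by
  unfold Op; simp only [Equiv.Perm.sameCycle_inv]

lemma op_bend {n τ : ℕ} (π : Equiv.Perm (Fin n)) (x : Fin n) (h : Op τ π x) :
    τ ≤ ((π⁻¹ (eend τ π⁻¹ x) : Fin n) : ℕ) := op_eend π⁻¹ x ((op_inv π x).2 h)

lemma op_LInv {n τ : ℕ} (x : Fin n) : LInv τ (fun π => Op τ π x) := by
  intro π h hh
  dsimp only
  rw [op_iff, op_iff]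
  have := eend_LInv x π h hh
  dsimp only at this
  rw [this, Equiv.Perm.mul_apply, eq_iff_iff, ← not_lt, ← not_lt, hh.lt_iff]

lemma op_RInv {n τ : ℕ} (x : Fin n) : RInv τ (fun π => Op τ π x) := by
  have := (op_LInv (τ := τ) x).inv
  simpa only [op_inv] using this

lemma sameCycle_inv_right {n : ℕ} {π : Equiv.Perm (Fin n)} {x y : Fin n}
    (h : π.SameCycle x y) : π.SameCycle x (π⁻¹ y) := by
  rw [← Equiv.Perm.sameCycle_apply_right]
  simpa using h

lemma eend_step {n τ : ℕ} (π : Equiv.Perm (Fin n)) (x : Fin n) (h : Op τ π x)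
    (hx : ((π x : Fin n) : ℕ) < τ) : eend τ π (π x) = eend τ π x := by
  have h1 := op_eend π x h
  have h2 := iter_stuck π x (k := n) h1 1
  rw [Function.iterate_add_apply, Function.iterate_one] at h2
  have h3 : gstep τ π x = π x := by unfold gstep; rw [if_pos hx]
  rw [h3] at h2
  exact h2

lemma op_congr {n τ : ℕ} {π : Equiv.Perm (Fin n)} {x y : Fin n} (hxy : π.SameCycle x y)
    (h : Op τ π x) : Op τ π y := by
  obtain ⟨z, hz, hz'⟩ := h
  exact ⟨z, hxy.symm.trans hz, hz'⟩

lemma op_mono {n τ τ' : ℕ} {π : Equiv.Perm (Fin n)} {x : Fin n} (hτ : τ ≤ τ')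
    (h : Op τ' π x) : Op τ π x := by
  obtain ⟨z, hz, hz'⟩ := h
  exact ⟨z, hz, hτ.trans hz'⟩

lemma eend_iter {n τ τ' : ℕ} (hτ : τ ≤ τ') (π : Equiv.Perm (Fin n)) (x : Fin n)
    (h : Op τ' π x) (k : ℕ) : eend τ' π ((gstep τ π)^[k] x) = eend τ' π x := by
  induction k with
  | zero => rfl
  | succ k ih =>
    rw [Function.iterate_succ_apply', ← ih]
    have h1 := op_congr (iter_sameCycle (τ := τ) π x k) h
    generalize (gstep τ π)^[k] x = y at h1
    unfold gstep
    split_ifs with h2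
    · exact eend_step π y h1 (by omega)
    · rfl

lemma eend_biter {n τ τ' : ℕ} (hτ : τ ≤ τ') (π : Equiv.Perm (Fin n)) (x : Fin n)
    (hx : (x : ℕ) < τ) (h : Op τ' π x) (k : ℕ) :
    eend τ' π ((gstep τ π⁻¹)^[k] x) = eend τ' π x := by
  induction k with
  | zero => rfl
  | succ k ih =>
    rw [Function.iterate_succ_apply', ← ih]
    have h0 := iter_lt π⁻¹ x hx k
    have h1 := op_congr (Equiv.Perm.sameCycle_inv.1 (iter_sameCycle (τ := τ) π⁻¹ x k)) h
    generalize (gstep τ π⁻¹)^[k] x = y at h1 h0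
    unfold gstep
    split_ifs with h2
    · have h3 : π (π⁻¹ y) = y := by simp
      have h4 : Op τ' π (π⁻¹ y) := op_congr (sameCycle_inv_right
        (Equiv.Perm.SameCycle.refl _ _)) h1
      have := eend_step π (π⁻¹ y) h4 (by rw [h3]; omega)
      rw [← this, h3]
    · rfl

lemma close_imp {n : ℕ} (τ : Fin n) (π : Equiv.Perm (Fin n)) (s : Fin n) (hs : (s : ℕ) < τ)
    (h : Op (τ : ℕ) π s) (h1 : π (eend (τ : ℕ) π s) = τ)
    (h2 : π τ = eend (τ : ℕ) π⁻¹ s) : ¬ Op ((τ : ℕ) + 1) π s := by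
  set A : Fin n → Prop := fun x => x = τ ∨
    ((x : ℕ) < τ ∧ eend (τ : ℕ) π x = eend (τ : ℕ) π s) with hA
  have hb : A (eend (τ : ℕ) π⁻¹ s) :=
    Or.inr ⟨eend_lt _ _ hs, eend_biter le_rfl π s hs h n⟩
  have key : ∀ k : ℕ, A ((π ^ k) s) := by
    intro k
    induction k with
    | zero => exact Or.inr ⟨hs, rfl⟩
    | succ k ih =>
      rw [pow_succ', Equiv.Perm.mul_apply]
      have hop : Op (τ : ℕ) π ((π ^ k) s) :=
        op_congr (Equiv.Perm.sameCycle_pow_right.2 (Equiv.Perm.SameCycle.refl _ _)) h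
      generalize (π ^ k) s = x at ih hop
      rcases ih with ih | ⟨ih1, ih2⟩
      · rw [ih, h2]; exact hb
      · by_cases hx : ((π x : Fin n) : ℕ) < τ
        · exact Or.inr ⟨hx, by rw [eend_step π x hop hx, ih2]⟩
        · left
          have : eend (τ : ℕ) π x = x := by
            have := iter_stuck (τ := τ) π x (k := 0) (not_lt.1 hx) n
            rw [zero_add] at this
            exact this
          rw [this] at ih2
          rw [ih2, h1]
  rintro ⟨y, hy, hy2⟩
  obtain ⟨i, _, _, rfl⟩ := hy.exists_pow_eq
  rcases key i with h3 | h3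
  · rw [h3] at hy2; omega
  · omega

lemma close_of {n : ℕ} (τ : Fin n) (π : Equiv.Perm (Fin n)) (s : Fin n)
    (h : Op (τ : ℕ) π s) (hn : ¬ Op ((τ : ℕ) + 1) π s) :
    π (eend (τ : ℕ) π s) = τ ∧ π τ = eend (τ : ℕ) π⁻¹ s := by
  have hle : ∀ y, π.SameCycle s y → (y : ℕ) ≤ τ := by
    intro y hy
    by_contra hc
    exact hn ⟨y, hy, by omega⟩
  have a1 := op_eend π s h
  have a2 := hle _ (Equiv.Perm.sameCycle_apply_right.2 (eend_sameCycle (τ := τ) π s))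
  have b1 := op_bend π s h
  have b2 := hle _ (sameCycle_inv_right
    (Equiv.Perm.sameCycle_inv.1 (eend_sameCycle (τ := τ) π⁻¹ s)))
  have b3 : π⁻¹ (eend (τ : ℕ) π⁻¹ s) = τ := Fin.ext (by omega)
  exact ⟨Fin.ext (by omega), (Equiv.Perm.inv_eq_iff_eq.1 b3).symm⟩

/-! ### joint law -/

lemma joint {n : ℕ} {q : ℝ} (hq : 0 < q) (τ : Fin n) (G : Equiv.Perm (Fin n) → ℝ)
    (e b : Equiv.Perm (Fin n) → Fin n)
    (hGR : RInv (τ : ℕ) G) (hGL : LInv (τ : ℕ) G)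
    (heR : RInv (τ : ℕ) e) (heL : LInv (τ : ℕ) e)
    (hbR : RInv (τ : ℕ) b) (hbL : LInv (τ : ℕ) b)
    (he : ∀ π, ((e π : Fin n) : ℕ) < τ) (hb : ∀ π, ((b π : Fin n) : ℕ) < τ)
    (hGe : ∀ π, G π ≠ 0 → (τ : ℕ) ≤ ((π (e π) : Fin n) : ℕ))
    (hGb : ∀ π, G π ≠ 0 → (τ : ℕ) ≤ ((π⁻¹ (b π) : Fin n) : ℕ)) :
    mExp n q (fun π => G π * ind (π (e π) = τ ∧ π τ = b π))
      = mExp n q (fun π => G π * q ^ (rk τ π (b π) + rk τ π⁻¹ (e π)))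
        * (1 / qn q (n - (τ : ℕ))) ^ 2 := by
  have s1 := kernel_point hq τ (fun π => G π * ind (π (e π) = τ)) b (by
      intro π h hh
      dsimp only
      rw [hGR π h hh, heR π h hh, Equiv.Perm.mul_apply, hh _ (he π)]) hbR (by
      intro π h0
      exact hGb π (left_ne_zero_of_mul h0))
  have s2 := kernel_point hq τ (fun π => G π⁻¹ * q ^ rk τ π⁻¹ (b π⁻¹)) (fun π => e π⁻¹) (by
      intro π h hh
      dsimp only
      rw [mul_inv_rev, hGL _ _ hh.inv, hbL _ _ hh.inv, rk_mul_left _ _ hh.inv _ (hb _).le])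
      heL.inv (by
      intro π h0
      exact hGe π⁻¹ (left_ne_zero_of_mul h0))
  rw [← mExp_inv, ← mExp_inv (fun π => G π⁻¹ * q ^ rk τ π⁻¹ (b π⁻¹) * _)] at s2
  simp only [inv_inv] at s2
  have t1 : mExp n q (fun π => G π * ind (π (e π) = τ ∧ π τ = b π))
      = mExp n q (fun π => G π * ind (π (e π) = τ) * ind (π τ = b π)) := by
    apply mExp_congr; intro π
    by_cases h1 : π (e π) = τ <;> by_cases h2 : π τ = b π <;> simp [ind, h1, h2]
  rw [t1, s1]
  have t2 : mExp n q (fun π => G π * ind (π (e π) = τ) * (q ^ rk τ π (b π) / qn q (n - (τ : ℕ))))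
      = 1 / qn q (n - (τ : ℕ)) *
        mExp n q (fun π => G π * q ^ rk τ π (b π) * ind (π⁻¹ τ = e π)) := by
    rw [← mExp_smul]
    apply mExp_congr; intro π
    have : (π⁻¹ τ = e π) ↔ (π (e π) = τ) := by
      rw [Equiv.Perm.inv_eq_iff_eq]; exact eq_comm
    rw [this]; ring
  rw [t2, s2, ← mExp_smul, mul_comm _ ((1 / qn q (n - (τ : ℕ))) ^ 2), ← mExp_smul]
  apply mExp_congr; intro π
  rw [pow_add]; ring

lemma joint_upper {n : ℕ} {q : ℝ} (hq : 0 < q) (hq1 : q < 1) (τ : Fin n)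
    (G : Equiv.Perm (Fin n) → ℝ)
    (e b : Equiv.Perm (Fin n) → Fin n)
    (hGR : RInv (τ : ℕ) G) (hGL : LInv (τ : ℕ) G)
    (heR : RInv (τ : ℕ) e) (heL : LInv (τ : ℕ) e)
    (hbR : RInv (τ : ℕ) b) (hbL : LInv (τ : ℕ) b)
    (he : ∀ π, ((e π : Fin n) : ℕ) < τ) (hb : ∀ π, ((b π : Fin n) : ℕ) < τ)
    (hGe : ∀ π, G π ≠ 0 → (τ : ℕ) ≤ ((π (e π) : Fin n) : ℕ))
    (hGb : ∀ π, G π ≠ 0 → (τ : ℕ) ≤ ((π⁻¹ (b π) : Fin n) : ℕ))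
    (hG0 : ∀ π, 0 ≤ G π) (hG1 : ∀ π, G π ≤ 1) :
    mExp n q (fun π => G π * ind (π (e π) = τ ∧ π τ = b π))
      ≤ (1 / qn q (n - (τ : ℕ))) ^ 2 := by
  rw [joint hq τ G e b hGR hGL heR heL hbR hbL he hb hGe hGb]
  have : mExp n q (fun π => G π * q ^ (rk τ π (b π) + rk τ π⁻¹ (e π))) ≤ 1 := by
    rw [← mExp_const (n := n) hq 1]
    apply mExp_mono hq
    intro π
    exact mul_le_one₀ (hG1 π) (by positivity) (pow_le_one₀ hq.le hq1.le)
  calc _ ≤ 1 * (1 / qn q (n - (τ : ℕ))) ^ 2 := mul_le_mul_of_nonneg_right this (sq_nonneg _)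
    _ = _ := one_mul _

lemma joint_lower {n : ℕ} {q : ℝ} (hq : 0 < q) (hq1 : q < 1) (τ : Fin n)
    (G : Equiv.Perm (Fin n) → ℝ)
    (e b : Equiv.Perm (Fin n) → Fin n)
    (hGR : RInv (τ : ℕ) G) (hGL : LInv (τ : ℕ) G)
    (heR : RInv (τ : ℕ) e) (heL : LInv (τ : ℕ) e)
    (hbR : RInv (τ : ℕ) b) (hbL : LInv (τ : ℕ) b)
    (he : ∀ π, ((e π : Fin n) : ℕ) < τ) (hb : ∀ π, ((b π : Fin n) : ℕ) < τ)
    (hGe : ∀ π, G π ≠ 0 → (τ : ℕ) ≤ ((π (e π) : Fin n) : ℕ))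
    (hGb : ∀ π, G π ≠ 0 → (τ : ℕ) ≤ ((π⁻¹ (b π) : Fin n) : ℕ))
    (hG0 : ∀ π, 0 ≤ G π) :
    mExp n q (fun π => G π * q ^ (2 * kap (τ : ℕ) π)) * (1 / qn q (n - (τ : ℕ))) ^ 2
      ≤ mExp n q (fun π => G π * ind (π (e π) = τ ∧ π τ = b π)) := by
  rw [joint hq τ G e b hGR hGL heR heL hbR hbL he hb hGe hGb]
  apply mul_le_mul_of_nonneg_right _ (sq_nonneg _)
  apply mExp_mono hq
  intro π
  apply mul_le_mul_of_nonneg_left _ (hG0 π)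
  apply pow_le_pow_of_le_one hq.le hq1.le
  have h1 := rk_le_kap (τ : ℕ) π (b π) (hb π).le
  have h2 := rk_le_kap (τ : ℕ) π⁻¹ (e π) (he π).le
  rw [kap_inv] at h2
  omega

/-! ### upper bound -/

lemma ind_op_RInv {n τ : ℕ} (s : Fin n) : RInv τ (fun π => ind (Op τ π s)) := by
  intro π h hh
  have := op_RInv s π h hh
  dsimp only at this ⊢
  rw [this]

lemma ind_op_LInv {n τ : ℕ} (s : Fin n) : LInv τ (fun π => ind (Op τ π s)) := by
  intro π h hh
  have := op_LInv s π h hh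
  dsimp only at this ⊢
  rw [this]

lemma of_ind_ne {P : Prop} (h : ind P ≠ 0) : P := by
  by_contra hc; exact h (ind_false hc)

lemma close_eq {n : ℕ} {q : ℝ} (τ s : Fin n) (hs : (s : ℕ) < τ) :
    mExp n q (fun π => ind (Op (τ : ℕ) π s)) - mExp n q (fun π => ind (Op ((τ : ℕ) + 1) π s))
    = mExp n q (fun π => ind (Op (τ : ℕ) π s) *
        ind (π (eend (τ : ℕ) π s) = τ ∧ π τ = eend (τ : ℕ) π⁻¹ s)) := by
  rw [← mExp_sub]
  apply mExp_congr
  intro π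
  by_cases h : Op (τ : ℕ) π s
  · rw [ind_true h]
    by_cases h2 : Op ((τ : ℕ) + 1) π s
    · rw [ind_true h2, ind_false]
      · ring
      · rintro ⟨a, b⟩; exact close_imp τ π s hs h a b h2
    · rw [ind_false h2, ind_true (close_of τ π s h h2)]; ring
  · rw [ind_false h, ind_false (fun h2 => h (op_mono (by omega) h2))]; ring

lemma close_upper {n : ℕ} {q : ℝ} (hq : 0 < q) (hq1 : q < 1) (τ s : Fin n) (hs : (s : ℕ) < τ) :
    mExp n q (fun π => ind (Op (τ : ℕ) π s)) - mExp n q (fun π => ind (Op ((τ : ℕ) + 1) π s))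
    ≤ (1 / qn q (n - (τ : ℕ))) ^ 2 := by
  rw [close_eq τ s hs]
  exact joint_upper hq hq1 τ _ _ _ (ind_op_RInv s) (ind_op_LInv s) (eend_RInv s hs) (eend_LInv s)
    (bend_RInv s) (bend_LInv s hs) (fun π => eend_lt _ _ hs) (fun π => eend_lt _ _ hs)
    (fun π h => op_eend _ _ (of_ind_ne h)) (fun π h => op_bend _ _ (of_ind_ne h))
    (fun _ => ind_nonneg _) (fun _ => ind_le_one _)

lemma close_lower {n : ℕ} {q : ℝ} (hq : 0 < q) (hq1 : q < 1) (τ s : Fin n) (hs : (s : ℕ) < τ) :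
    mExp n q (fun π => ind (Op (τ : ℕ) π s) * q ^ (2 * kap (τ : ℕ) π)) * (1 - q) ^ 2 ≤
    mExp n q (fun π => ind (Op (τ : ℕ) π s)) - mExp n q (fun π => ind (Op ((τ : ℕ) + 1) π s)) := by
  rw [close_eq τ s hs]
  refine le_trans ?_ (joint_lower hq hq1 τ _ _ _ (ind_op_RInv s) (ind_op_LInv s) (eend_RInv s hs)
    (eend_LInv s)
    (bend_RInv s) (bend_LInv s hs) (fun π => eend_lt _ _ hs) (fun π => eend_lt _ _ hs)
    (fun π h => op_eend _ _ (of_ind_ne h)) (fun π h => op_bend _ _ (of_ind_ne h))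
    (fun _ => ind_nonneg _))
  apply mul_le_mul_of_nonneg_left
  · have h1 := qn_le hq hq1 (n - (τ : ℕ))
    have h2 := qn_pos hq (m := n - (τ : ℕ)) (by omega)
    have h3 : 0 < 1 - q := by linarith
    apply pow_le_pow_left₀ h3.le
    rw [le_div_iff₀ h2]
    rw [le_div_iff₀ h3] at h1
    linarith
  · exact mExp_nonneg hq fun π => mul_nonneg (ind_nonneg _) (by positivity)

lemma lyap_step {n : ℕ} {q : ℝ} (hq : 0 < q) (hq1 : q < 1) (τ s : Fin n) (hs : (s : ℕ) < τ) :
    mExp n q (fun π => ind (Op ((τ : ℕ) + 1) π s) * kap ((τ : ℕ) + 1) π)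
      + 2 / (1 - q) ^ 2 * mExp n q (fun π => ind (Op ((τ : ℕ) + 1) π s))
    ≤ mExp n q (fun π => ind (Op (τ : ℕ) π s) * kap (τ : ℕ) π)
      + 2 / (1 - q) ^ 2 * mExp n q (fun π => ind (Op (τ : ℕ) π s))
      - 1 / 2 * mExp n q (fun π => ind (Op (τ : ℕ) π s)) := by
  have hp : 0 < (1 - q) ^ 2 := by
    have : 0 < 1 - q := by linarith
    positivity
  have h1 : mExp n q (fun π => ind (Op ((τ : ℕ) + 1) π s) * kap ((τ : ℕ) + 1) π)
      ≤ mExp n q (fun π => ind (Op (τ : ℕ) π s) * kap ((τ : ℕ) + 1) π) := by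
    apply mExp_mono hq
    intro π
    exact mul_le_mul_of_nonneg_right (ind_mono (op_mono (by omega))) (Nat.cast_nonneg _)
  have h2 := drift hq τ _ (ind_op_RInv s) (ind_op_LInv s) (fun π => ind_nonneg _)
  have h3 : mExp n q (fun π => ind (Op (τ : ℕ) π s) * (2 * q ^ kap (τ : ℕ) π - 1))
      ≤ 2 * mExp n q (fun π => ind (Op (τ : ℕ) π s) * q ^ (2 * kap (τ : ℕ) π))
        - 1 / 2 * mExp n q (fun π => ind (Op (τ : ℕ) π s)) := by
    rw [← mExp_smul, ← mExp_smul, ← mExp_sub]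
    apply mExp_mono hq
    intro π
    have : q ^ (2 * kap (τ : ℕ) π) = (q ^ kap (τ : ℕ) π) ^ 2 := by rw [← pow_mul, mul_comm]
    rw [this]
    nlinarith [mul_nonneg (ind_nonneg (Op (τ : ℕ) π s))
      (sq_nonneg (q ^ kap (τ : ℕ) π - 1 / 2))]
  have h4 := close_lower hq hq1 τ s hs
  rw [← le_div_iff₀ hp] at h4
  have h5 : 2 / (1 - q) ^ 2 * mExp n q (fun π => ind (Op (τ : ℕ) π s)) -
      2 / (1 - q) ^ 2 * mExp n q (fun π => ind (Op ((τ : ℕ) + 1) π s))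
      = 2 * ((mExp n q (fun π => ind (Op (τ : ℕ) π s)) -
        mExp n q (fun π => ind (Op ((τ : ℕ) + 1) π s))) / (1 - q) ^ 2) := by ring
  linarith

lemma sum_op_le {n : ℕ} {q : ℝ} (hq : 0 < q) (hq1 : q < 1) (s : Fin n) :
    ∑ τ ∈ Finset.range n, (if (s : ℕ) < τ then mExp n q (fun π => ind (Op τ π s)) else 0)
      ≤ 6 / (1 - q) ^ 2 := by
  have hp : 0 < 1 - q := by linarith
  set Φ : ℕ → ℝ := fun τ => mExp n q (fun π => ind (Op τ π s) * kap τ π)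
      + 2 / (1 - q) ^ 2 * mExp n q (fun π => ind (Op τ π s)) with hΦ
  have hΦ0 : ∀ τ, 0 ≤ Φ τ := fun τ => add_nonneg
    (mExp_nonneg hq fun π => mul_nonneg (ind_nonneg _) (Nat.cast_nonneg _))
    (mul_nonneg (by positivity) (mExp_nonneg hq fun π => ind_nonneg _))
  have key : ∀ N ≤ n,
      ∑ τ ∈ Finset.range N, (if (s : ℕ) < τ then mExp n q (fun π => ind (Op τ π s)) else 0)
      ≤ 2 * Φ ((s : ℕ) + 1) - 2 * Φ (max N ((s : ℕ) + 1)) := by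
    intro N
    induction N with
    | zero => intro _; simp
    | succ N ih =>
      intro hN
      rw [Finset.sum_range_succ]
      have ih := ih (by omega)
      split_ifs with h
      · have := lyap_step hq hq1 ⟨N, by omega⟩ s h
        dsimp only at this
        rw [max_eq_left (by omega)] at ih ⊢
        simp only [hΦ] at ih ⊢
        linarith
      · rw [max_eq_right (by omega)] at ih ⊢
        linarith
  have h1 := key n le_rfl
  have h2 := hΦ0 (max n ((s : ℕ) + 1))
  have h3 : Φ ((s : ℕ) + 1) ≤ 3 / (1 - q) ^ 2 := by
    have a1 : mExp n q (fun π => ind (Op ((s : ℕ) + 1) π s) * kap ((s : ℕ) + 1) π)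
        ≤ 1 / (1 - q) := by
      refine le_trans (mExp_mono hq fun π => ?_) (mExp_kap_le hq hq1 ((s : ℕ) + 1))
      exact mul_le_of_le_one_left (Nat.cast_nonneg _) (ind_le_one _)
    have a2 : mExp n q (fun π => ind (Op ((s : ℕ) + 1) π s)) ≤ 1 := by
      rw [← mExp_const (n := n) hq 1]
      exact mExp_mono hq fun π => ind_le_one _
    have a3 : 1 / (1 - q) ≤ 1 / (1 - q) ^ 2 := by
      apply one_div_le_one_div_of_le (by positivity)
      nlinarith
    have a4 := mul_le_mul_of_nonneg_left a2 (show 0 ≤ 2 / (1 - q) ^ 2 by positivity)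
    have a5 : 3 / (1 - q) ^ 2 = 1 / (1 - q) ^ 2 + 2 / (1 - q) ^ 2 * 1 := by ring
    simp only [hΦ]
    linarith
  have h4 : 6 / (1 - q) ^ 2 = 2 * (3 / (1 - q) ^ 2) := by ring
  linarith

lemma card_cycleSet {n : ℕ} (π : Equiv.Perm (Fin n)) (s : Fin n) :
    ((cycleSet n π s).card : ℝ) = ∑ j, ind (π.SameCycle s j) := by
  unfold cycleSet
  exact card_eq_sum_ind _

lemma half_le {n : ℕ} {q : ℝ} (hq : 0 < q) (hq1 : q < 1) (s : Fin n) :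
    mExp n q (fun π => ∑ j : Fin n, ind (s < j ∧ π.SameCycle s j)) ≤ 6 / (1 - q) ^ 2 := by
  refine le_trans ?_ (sum_op_le hq hq1 s)
  rw [mExp_sum, ← Fin.sum_univ_eq_sum_range
    (fun τ => if (s : ℕ) < τ then mExp n q (fun π => ind (Op τ π s)) else 0)]
  apply Finset.sum_le_sum
  intro j _
  split_ifs with h
  · exact mExp_mono hq fun π => ind_mono fun hh => ⟨j, hh.2, le_rfl⟩
  · apply le_of_eq
    rw [← mExp_const (n := n) hq 0]
    exact mExp_congr fun π => ind_false (fun hh => h hh.1)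

lemma upper_bound {n : ℕ} {q : ℝ} (hq : 0 < q) (hq1 : q < 1) (s : Fin n) :
    mExp n q (fun π => ((cycleSet n π s).card : ℝ)) ≤ 13 * ((1 - q) ^ 2)⁻¹ := by
  have h1 := half_le hq hq1 s
  have h2 := half_le hq hq1 s.rev
  rw [← mExp_rev] at h2
  have h3 : mExp n q (fun π => ((cycleSet n π s).card : ℝ)) ≤
      1 + mExp n q (fun π => ∑ j : Fin n, ind (s < j ∧ π.SameCycle s j)) +
      mExp n q (fun π => ∑ j : Fin n,
        ind (s.rev < j ∧ (Fin.revPerm * π * Fin.revPerm).SameCycle s.rev j)) := by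
    rw [← mExp_const (n := n) hq 1, ← mExp_add, ← mExp_add]
    apply le_of_eq
    apply mExp_congr
    intro π
    have hs : (∑ j : Fin n, ind (s.rev < j ∧
          (Fin.revPerm * π * Fin.revPerm : Equiv.Perm (Fin n)).SameCycle s.rev j))
        = ∑ j : Fin n, ind (s.rev < j.rev ∧
          (Fin.revPerm * π * Fin.revPerm : Equiv.Perm (Fin n)).SameCycle s.rev j.rev) :=
      (Equiv.sum_comp (Fin.revPerm : Equiv.Perm (Fin n)) (fun j : Fin n => ind (s.rev < j ∧
          (Fin.revPerm * π * Fin.revPerm : Equiv.Perm (Fin n)).SameCycle s.rev j))).symm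
    rw [card_cycleSet, hs]
    have e : (1 : ℝ) = ∑ j : Fin n, if j = s then 1 else 0 := by simp
    rw [e, ← Finset.sum_add_distrib, ← Finset.sum_add_distrib]
    apply Finset.sum_congr rfl
    intro j _
    simp only [sameCycle_rev, Fin.rev_rev, Fin.revPerm_apply, Fin.rev_lt_rev]
    rcases lt_trichotomy j s with h | h | h
    · rw [if_neg h.ne]
      simp [ind, h, h.not_gt]
    · subst h; simp [ind, Equiv.Perm.SameCycle.refl]
    · rw [if_neg h.ne']
      simp [ind, h, h.not_gt]
  have h4 : 1 ≤ 1 / (1 - q) ^ 2 := by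
    rw [le_div_iff₀ (by have : 0 < 1 - q := by linarith
                        positivity)]
    nlinarith
  have h5 : 13 * ((1 - q) ^ 2)⁻¹ = 1 / (1 - q) ^ 2 + 6 / (1 - q) ^ 2 + 6 / (1 - q) ^ 2 := by ring
  linarith

/-! ### lower bound -/

lemma qn_mul {q : ℝ} (m : ℕ) : qn q m * (1 - q) = 1 - q ^ m := by
  have := geom_sum_mul q m
  unfold qn
  linarith

lemma inv_qn_le {q : ℝ} (hq : 0 < q) (hq1 : q < 1) {m : ℕ} (hm : 0 < m) :
    1 / qn q m ≤ 1 / m + (1 - q) := by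
  have hp : 0 < 1 - q := by linarith
  have hm' : (0 : ℝ) < m := by exact_mod_cast hm
  have h1 : ∀ m : ℕ, (1 + m * (1 - q)) * q ^ m ≤ 1 := by
    intro m
    induction m with
    | zero => simp
    | succ m ih =>
      refine le_trans ?_ ih
      rw [pow_succ]
      push_cast
      have h2 : (1 + ((m : ℝ) + 1) * (1 - q)) * q ≤ 1 + m * (1 - q) := by
        nlinarith [mul_nonneg (Nat.cast_nonneg (α := ℝ) m) (mul_self_nonneg (1 - q)),
          mul_self_nonneg (1 - q)]
      calc _ = ((1 + ((m : ℝ) + 1) * (1 - q)) * q) * q ^ m := by ring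
        _ ≤ _ := mul_le_mul_of_nonneg_right h2 (by positivity)
  have h2 := h1 m
  have h3 := qn_mul (q := q) m
  have h4 := qn_pos hq hm
  have h5 : (m : ℝ) ≤ qn q m * (1 + m * (1 - q)) := by
    have : (m : ℝ) * (1 - q) ≤ (qn q m * (1 + m * (1 - q))) * (1 - q) := by
      have : (qn q m * (1 + m * (1 - q))) * (1 - q) = (1 + m * (1 - q)) * (1 - q ^ m) := by
        rw [← h3]; ring
      rw [this]; linarith
    exact le_of_mul_le_mul_right this hp
  rw [div_le_iff₀ h4]
  have : (1 / (m : ℝ) + (1 - q)) * qn q m = qn q m * (1 + m * (1 - q)) / m := by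
    field_simp
  rw [this, le_div_iff₀ hm']
  linarith

def lam (q : ℝ) (n τ : ℕ) : ℝ := (1 / qn q (n - τ)) ^ 2

lemma lam_nonneg (q : ℝ) (n τ : ℕ) : 0 ≤ lam q n τ := sq_nonneg _

lemma lam_last (q : ℝ) {n : ℕ} (hn : 0 < n) : lam q n (n - 1) = 1 := by
  unfold lam
  have : n - (n - 1) = 1 := by omega
  rw [this]; simp [qn]

lemma lam_step {q : ℝ} (hq : 0 < q) (hq1 : q < 1) {n τ : ℕ} (hτ : τ + 1 < n)
    (h : lam q n τ ≤ 1 / 4) : lam q n (τ + 1) ≤ 4 * lam q n τ := by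
  unfold lam at *
  obtain ⟨m, hm⟩ : ∃ m, n - (τ + 1) = m := ⟨_, rfl⟩
  have hm2 : n - τ = m + 1 := by omega
  rw [hm2] at h ⊢
  rw [hm]
  have hm0 : 0 < m := by omega
  have p1 := qn_pos hq hm0
  have p2 := qn_pos hq (Nat.succ_pos m)
  have e : qn q (m + 1) = qn q m + q ^ m := by unfold qn; rw [Finset.sum_range_succ]
  have hle : q ^ m ≤ 1 := pow_le_one₀ hq.le hq1.le
  have h2 : 1 / qn q (m + 1) ≤ 1 / 2 := by
    apply le_of_sq_le_sq _ (by norm_num)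
    norm_num at h ⊢
    linarith
  have h3 : 2 ≤ qn q (m + 1) := by
    rw [div_le_div_iff₀ p2 (by norm_num)] at h2
    linarith
  have h4 : 1 / qn q m ≤ 2 * (1 / qn q (m + 1)) := by
    rw [mul_one_div, div_le_div_iff₀ p1 p2]
    linarith
  calc (1 / qn q m) ^ 2 ≤ (2 * (1 / qn q (m + 1))) ^ 2 := pow_le_pow_left₀ (by positivity) h4 2
    _ = _ := by ring

lemma prob_not {n : ℕ} {q : ℝ} (hq : 0 < q) (P : Equiv.Perm (Fin n) → Prop) :
    mExp n q (fun π => ind (¬ P π)) = 1 - mExp n q (fun π => ind (P π)) := by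
  rw [← mExp_const (n := n) hq 1, ← mExp_sub]
  apply mExp_congr
  intro π
  by_cases h : P π
  · rw [ind_true h, ind_false (not_not.2 h)]; ring
  · rw [ind_false h, ind_true h]; ring

lemma not_op_first {n : ℕ} {q : ℝ} (hq : 0 < q) (hq1 : q < 1) (t : Fin n) :
    mExp n q (fun π => ind (¬ Op ((t : ℕ) + 1) π t)) ≤ 1 / qn q (n - (t : ℕ)) := by
  have hop : ∀ π : Equiv.Perm (Fin n), Op (t : ℕ) π t :=
    fun π => ⟨t, Equiv.Perm.SameCycle.refl _ _, le_rfl⟩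
  have k := kernel_point hq t (fun _ => 1) (fun π => eend (t : ℕ) π⁻¹ t) (by
    intro π h hh; rfl) (bend_RInv t) (fun π _ => op_bend π t (hop π))
  have p := qn_pos hq (m := n - (t : ℕ)) (by omega)
  calc _ ≤ mExp n q (fun π => 1 * ind (π t = eend (t : ℕ) π⁻¹ t)) := by
        apply mExp_mono hq
        intro π
        rw [one_mul]
        exact ind_mono fun h => (close_of t π t (hop π) h).2
    _ = _ := k
    _ ≤ mExp n q (fun _ => 1 / qn q (n - (t : ℕ))) := by
        apply mExp_mono hq
        intro π
        rw [one_mul]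
        exact div_le_div_of_nonneg_right (pow_le_one₀ hq.le hq1.le) p.le
    _ = _ := mExp_const hq _

lemma not_op_le {n : ℕ} {q : ℝ} (hq : 0 < q) (hq1 : q < 1) (t : Fin n) (U : ℕ)
    (hU : (t : ℕ) + 1 ≤ U) (hn : U ≤ n) :
    mExp n q (fun π => ind (¬ Op U π t)) ≤ 1 / qn q (n - (t : ℕ))
      + ∑ τ ∈ Finset.Ico ((t : ℕ) + 1) U, lam q n τ := by
  induction U, hU using Nat.le_induction with
  | base => simpa using not_op_first hq hq1 t
  | succ U hU ih =>
    have ih := ih (by omega)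
    rw [Finset.sum_Ico_succ_top hU]
    have := close_upper hq hq1 ⟨U, by omega⟩ t (by simp only; omega)
    dsimp only at this
    rw [prob_not hq] at ih ⊢
    unfold lam at *
    linarith

/-! ### merging -/

def Dd {n : ℕ} (τ : ℕ) (π : Equiv.Perm (Fin n)) (s t : Fin n) : Prop :=
  Op τ π s ∧ Op τ π t ∧ eend τ π s ≠ eend τ π t

def Mm {n : ℕ} (τ : ℕ) (π : Equiv.Perm (Fin n)) (s t : Fin n) : Prop :=
  Dd τ π s t ∧ ((π (eend τ π s) : Fin n) : ℕ) = τ ∧ π (π (eend τ π s)) = eend τ π⁻¹ t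

lemma Mm_same {n τ : ℕ} {π : Equiv.Perm (Fin n)} {s t : Fin n} (h : Mm τ π s t) :
    π.SameCycle s t := by
  obtain ⟨-, -, h2⟩ := h
  have a := eend_sameCycle (τ := τ) π s
  have b := Equiv.Perm.sameCycle_inv.1 (eend_sameCycle (τ := τ) π⁻¹ t)
  have c : π.SameCycle s (π (π (eend τ π s))) :=
    Equiv.Perm.sameCycle_apply_right.2 (Equiv.Perm.sameCycle_apply_right.2 a)
  rw [h2] at c
  exact c.trans b.symm

lemma Mm_disj {n τ τ' : ℕ} {π : Equiv.Perm (Fin n)} {s t : Fin n} (ht : (t : ℕ) < τ)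
    (hτ : τ < τ') (h : Mm τ π s t) (h' : Dd τ' π s t) : False := by
  obtain ⟨-, h1, h2⟩ := h
  obtain ⟨os, ot, hne⟩ := h'
  apply hne
  have e1 : eend τ' π (eend τ π s) = eend τ' π s := eend_iter hτ.le π s os n
  have o1 := op_congr (eend_sameCycle (τ := τ) π s) os
  have e2 := eend_step π (eend τ π s) o1 (by omega)
  have o2 : Op τ' π (π (eend τ π s)) :=
    op_congr (Equiv.Perm.sameCycle_apply_right.2 (eend_sameCycle (τ := τ) π s)) os
  have hb := eend_lt (τ := τ) π⁻¹ t ht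
  have e3 := eend_step π (π (eend τ π s)) o2 (by rw [h2]; omega)
  have e4 : eend τ' π (eend τ π⁻¹ t) = eend τ' π t := eend_biter hτ.le π t ht ot n
  rw [h2, e4, e2, e1] at e3
  exact e3.symm

lemma sum_M_le {n : ℕ} (π : Equiv.Perm (Fin n)) (s t : Fin n) (A : Finset ℕ)
    (hA : ∀ τ ∈ A, (t : ℕ) < τ) : ∑ τ ∈ A, ind (Mm τ π s t) ≤ ind (π.SameCycle s t) := by
  by_cases h : ∃ τ ∈ A, Mm τ π s t
  · obtain ⟨τ, hτ, hM⟩ := h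
    rw [Finset.sum_eq_single τ]
    · exact ind_mono Mm_same
    · intro τ' hτ' hne
      apply ind_false
      intro hM'
      rcases lt_or_gt_of_ne hne with h | h
      · exact Mm_disj (hA _ hτ') h hM' hM.1
      · exact Mm_disj (hA _ hτ) h hM hM'.1
    · intro h; exact absurd hτ h
  · push Not at h
    rw [Finset.sum_eq_zero]
    · exact ind_nonneg _
    · intro τ hτ; exact ind_false (h τ hτ)

lemma ind_D_RInv {n τ : ℕ} (s t : Fin n) (hs : (s : ℕ) < τ) (ht : (t : ℕ) < τ) :
    RInv τ (fun π => ind (Dd τ π s t)) := by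
  intro π h hh
  have h1 := op_RInv s π h hh
  have h2 := op_RInv t π h hh
  have h3 := eend_RInv s hs π h hh
  have h4 := eend_RInv t ht π h hh
  dsimp only at *
  unfold Dd
  rw [h1, h2, h3, h4]

lemma ind_D_LInv {n τ : ℕ} (s t : Fin n) :
    LInv τ (fun π => ind (Dd τ π s t)) := by
  intro π h hh
  have h1 := op_LInv s π h hh
  have h2 := op_LInv t π h hh
  have h3 := eend_LInv s π h hh
  have h4 := eend_LInv t π h hh
  dsimp only at *
  unfold Dd
  rw [h1, h2, h3, h4]

lemma prob_M {n : ℕ} {q : ℝ} (hq : 0 < q) (hq1 : q < 1) (τ s t : Fin n)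
    (hs : (s : ℕ) < τ) (ht : (t : ℕ) < τ) :
    mExp n q (fun π => ind (Dd (τ : ℕ) π s t) * q ^ (2 * kap (τ : ℕ) π)) * lam q n τ
      ≤ mExp n q (fun π => ind (Mm (τ : ℕ) π s t)) := by
  refine le_trans (joint_lower hq hq1 τ _ _ _ (ind_D_RInv s t hs ht) (ind_D_LInv s t)
    (eend_RInv s hs) (eend_LInv s)
    (bend_RInv t) (bend_LInv t ht) (fun π => eend_lt _ _ hs) (fun π => eend_lt _ _ ht)
    (fun π h => op_eend _ _ (of_ind_ne h).1) (fun π h => op_bend _ _ (of_ind_ne h).2.1)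
    (fun _ => ind_nonneg _)) ?_
  apply mExp_mono hq
  intro π
  by_cases h : Dd (τ : ℕ) π s t ∧ (π (eend (τ : ℕ) π s) = τ ∧ π τ = eend (τ : ℕ) π⁻¹ t)
  · obtain ⟨h0, h1, h2⟩ := h
    have : Mm (τ : ℕ) π s t := ⟨h0, by rw [h1], by rw [h1, h2]⟩
    rw [ind_true this, ind_true h0, ind_true ⟨h1, h2⟩, one_mul]
  · have : ind (Dd (τ : ℕ) π s t) *
        ind (π (eend (τ : ℕ) π s) = τ ∧ π τ = eend (τ : ℕ) π⁻¹ t) = 0 := by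
      by_cases h0 : Dd (τ : ℕ) π s t
      · rw [ind_false (fun h1 => h ⟨h0, h1⟩), mul_zero]
      · rw [ind_false h0, zero_mul]
    rw [this]; exact ind_nonneg _

lemma pow_kap_ge {q : ℝ} (hq : 1 / 2 ≤ q) (hq1 : q < 1) (k : ℕ) :
    Real.exp (-16) * (1 - (1 - q) * k / 4) ≤ q ^ (2 * k) := by
  have hq0 : 0 < q := by linarith
  have h1 : Real.exp (-2 * (1 - q)) ≤ q := by
    rw [← Real.le_log_iff_exp_le hq0]
    have := Real.one_sub_inv_le_log_of_pos hq0
    refine le_trans ?_ this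
    have h2 : 1 - q⁻¹ = -((1 - q) / q) := by field_simp; ring
    rw [h2]
    have : (1 - q) / q ≤ 2 * (1 - q) := by
      rw [div_le_iff₀ hq0]; nlinarith
    linarith
  have h2 : Real.exp (-2 * (1 - q)) ^ (2 * k) ≤ q ^ (2 * k) :=
    pow_le_pow_left₀ (Real.exp_pos _).le h1 _
  refine le_trans ?_ h2
  rw [← Real.exp_nat_mul]
  have h3 : ((2 * k : ℕ) : ℝ) * (-2 * (1 - q)) = -16 + (16 - 4 * ((1 - q) * k)) := by
    push_cast; ring
  rw [h3, Real.exp_add]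
  apply mul_le_mul_of_nonneg_left _ (Real.exp_pos _).le
  by_cases h : (1 - q) * k ≤ 4
  · by_cases h0 : 0 ≤ (1 - q) * k
    · have := Real.one_le_exp (show 0 ≤ 16 - 4 * ((1 - q) * k) by linarith)
      linarith
    · have := Real.add_one_le_exp (16 - 4 * ((1 - q) * k))
      linarith
  · have := Real.exp_pos (16 - 4 * ((1 - q) * k))
    linarith

lemma prob_D_pow {n : ℕ} {q : ℝ} (hq : 1 / 2 ≤ q) (hq1 : q < 1) (τ : ℕ) (s t : Fin n) :
    Real.exp (-16) * (mExp n q (fun π => ind (Dd τ π s t)) - 1 / 4)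
      ≤ mExp n q (fun π => ind (Dd τ π s t) * q ^ (2 * kap τ π)) := by
  have hq0 : 0 < q := by linarith
  have hp : 0 < 1 - q := by linarith
  have h1 : mExp n q (fun π => Real.exp (-16) * (ind (Dd τ π s t) - (1 - q) / 4 * kap τ π))
      ≤ mExp n q (fun π => ind (Dd τ π s t) * q ^ (2 * kap τ π)) := by
    apply mExp_mono hq0
    intro π
    by_cases h : Dd τ π s t
    · rw [ind_true h, one_mul]
      have := pow_kap_ge hq hq1 (kap τ π)
      refine le_trans (le_of_eq ?_) this
      ring
    · rw [ind_false h, zero_mul]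
      apply mul_nonpos_of_nonneg_of_nonpos (Real.exp_pos _).le
      have : 0 ≤ (1 - q) / 4 * (kap τ π : ℝ) := by positivity
      linarith
  refine le_trans ?_ h1
  rw [mExp_smul, mExp_sub, mExp_smul]
  apply mul_le_mul_of_nonneg_left _ (Real.exp_pos _).le
  have h2 := mExp_kap_le (n := n) hq0 hq1 τ
  have h3 : (1 - q) / 4 * mExp n q (fun π => (kap τ π : ℝ)) ≤ (1 - q) / 4 * (1 / (1 - q)) :=
    mul_le_mul_of_nonneg_left h2 (by positivity)
  have h4 : (1 - q) / 4 * (1 / (1 - q)) = 1 / 4 := by field_simp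
  linarith

lemma prob_D_ge {n : ℕ} {q : ℝ} (hq : 0 < q) (τ : ℕ) (s t : Fin n) :
    1 - mExp n q (fun π => ind (¬ Op τ π s)) - mExp n q (fun π => ind (¬ Op τ π t))
      - mExp n q (fun π => ind (π.SameCycle s t)) ≤ mExp n q (fun π => ind (Dd τ π s t)) := by
  have : mExp n q (fun π => 1 - ind (¬ Op τ π s) - ind (¬ Op τ π t) - ind (π.SameCycle s t))
      ≤ mExp n q (fun π => ind (Dd τ π s t)) := by
    apply mExp_mono hq
    intro π
    have a1 := ind_nonneg (¬ Op τ π s)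
    have a2 := ind_nonneg (¬ Op τ π t)
    have a3 := ind_nonneg (π.SameCycle s t)
    have a4 := ind_nonneg (Dd τ π s t)
    by_cases h1 : Op τ π s
    · by_cases h2 : Op τ π t
      · by_cases h3 : eend τ π s = eend τ π t
        · have : π.SameCycle s t := by
            have b1 := eend_sameCycle (τ := τ) π s
            have b2 := eend_sameCycle (τ := τ) π t
            rw [h3] at b1
            exact b1.trans b2.symm
          rw [ind_true this] at *
          linarith
        · have : Dd τ π s t := ⟨h1, h2, h3⟩
          rw [ind_true this] at *
          linarith
      · rw [ind_true h2] at *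
        linarith
    · rw [ind_true h1] at *
      linarith
  rw [mExp_sub, mExp_sub, mExp_sub, mExp_const hq] at this
  exact this

lemma core {n : ℕ} {q : ℝ} (hq : 1 / 2 ≤ q) (hq1 : q < 1) (s t : Fin n) (T U : ℕ)
    (hs : (s : ℕ) ≤ T) (ht : (t : ℕ) ≤ T) (hU : U ≤ n)
    (h1 : ∀ τ ∈ Finset.Ico (T + 1) U, mExp n q (fun π => ind (¬ Op τ π s)) ≤ 1 / 4)
    (h2 : ∀ τ ∈ Finset.Ico (T + 1) U, mExp n q (fun π => ind (¬ Op τ π t)) ≤ 1 / 4)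
    (h3 : 1 / 80 ≤ ∑ τ ∈ Finset.Ico (T + 1) U, lam q n τ) :
    Real.exp (-16) / 640 ≤ mExp n q (fun π => ind (π.SameCycle s t)) := by
  have hq0 : 0 < q := by linarith
  by_contra hc
  push Not at hc
  have e1 : Real.exp (-16) ≤ 1 := Real.exp_le_one_iff.2 (by norm_num)
  have e0 := Real.exp_pos (-16)
  have hS : ∑ τ ∈ Finset.Ico (T + 1) U, mExp n q (fun π => ind (Mm τ π s t))
      ≤ mExp n q (fun π => ind (π.SameCycle s t)) := by
    rw [← mExp_sum]
    apply mExp_mono hq0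
    intro π
    apply sum_M_le
    intro τ hτ
    rw [Finset.mem_Ico] at hτ
    omega
  have hL : ∑ τ ∈ Finset.Ico (T + 1) U, Real.exp (-16) / 8 * lam q n τ
      ≤ ∑ τ ∈ Finset.Ico (T + 1) U, mExp n q (fun π => ind (Mm τ π s t)) := by
    apply Finset.sum_le_sum
    intro τ hτ
    have a1 := h1 τ hτ
    have a2 := h2 τ hτ
    rw [Finset.mem_Ico] at hτ
    have a3 := prob_M hq0 hq1 ⟨τ, by omega⟩ s t (by simp only; omega) (by simp only; omega)
    dsimp only at a3
    refine le_trans ?_ a3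
    apply mul_le_mul_of_nonneg_right _ (lam_nonneg _ _ _)
    have a4 := prob_D_pow hq hq1 τ s t
    refine le_trans ?_ a4
    have a5 := prob_D_ge hq0 τ s t
    have : 1 / 8 ≤ mExp n q (fun π => ind (Dd τ π s t)) - 1 / 4 := by linarith
    have := mul_le_mul_of_nonneg_left this e0.le
    linarith
  rw [← Finset.mul_sum] at hL
  have := mul_le_mul_of_nonneg_left h3 (show 0 ≤ Real.exp (-16) / 8 by positivity)
  linarith

lemma exists_U (a : ℕ → ℝ) (n T : ℕ) (ha : ∀ τ, 0 ≤ a τ)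
    (hstep : ∀ τ, τ + 1 < n → a τ ≤ 1 / 4 → a (τ + 1) ≤ 4 * a τ)
    (hlast : a (n - 1) = 1) (hT : T + 1 < n) (h0 : a (T + 1) ≤ 1 / 16) :
    ∃ U ≤ n, 1 / 80 ≤ ∑ τ ∈ Finset.Ico (T + 1) U, a τ ∧
      ∑ τ ∈ Finset.Ico (T + 1) U, a τ ≤ 1 / 16 := by
  have hex : ∃ U, 1 / 16 < ∑ τ ∈ Finset.Ico (T + 1) U, a τ := by
    refine ⟨n, ?_⟩
    have := Finset.single_le_sum (f := a) (s := Finset.Ico (T + 1) n) (fun i _ => ha i)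
      (show n - 1 ∈ Finset.Ico (T + 1) n by rw [Finset.mem_Ico]; omega)
    rw [hlast] at this
    linarith
  have hf := Nat.find_spec hex
  have hmin : ∀ m, m < Nat.find hex → _ := fun m hm => Nat.find_min hex hm
  have hle : Nat.find hex ≤ n := by
    apply Nat.find_min'
    have := Finset.single_le_sum (f := a) (s := Finset.Ico (T + 1) n) (fun i _ => ha i)
      (show n - 1 ∈ Finset.Ico (T + 1) n by rw [Finset.mem_Ico]; omega)
    rw [hlast] at this
    linarith
  generalize Nat.find hex = U at hf hmin hle
  have hU : T + 1 < U := by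
    by_contra hc
    rw [Finset.Ico_eq_empty (by omega)] at hf
    norm_num at hf
  obtain ⟨V, rfl⟩ : ∃ V, U = V + 1 := ⟨U - 1, by omega⟩
  have hV := not_lt.1 (hmin V (by omega))
  rw [Finset.sum_Ico_succ_top (by omega)] at hf
  have hV2 : T + 1 < V := by
    by_contra hc
    have : V = T + 1 := by omega
    subst this
    simp at hf
    linarith
  obtain ⟨W, rfl⟩ : ∃ W, V = W + 1 := ⟨V - 1, by omega⟩
  have hW := Finset.single_le_sum (f := a) (s := Finset.Ico (T + 1) (W + 1)) (fun i _ => ha i)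
      (show W ∈ Finset.Ico (T + 1) (W + 1) by rw [Finset.mem_Ico]; omega)
  have := hstep W (by omega) (by linarith)
  exact ⟨W + 1, by omega, by linarith, hV⟩

lemma pair_lower {n : ℕ} {q : ℝ} (hq1 : q < 1) (hp : 1 - q ≤ 1 / 16) (hn : 256 ≤ n)
    (s t : Fin n) (hs : 2 * (s : ℕ) + 1 ≤ n) (N : ℕ) (hN1 : 64 * (1 - q) ^ 2 * N ≤ 1)
    (hN2 : 8 * N ≤ n) (hst : s ≤ t) (ht : (t : ℕ) ≤ s + N) :
    Real.exp (-16) / 640 ≤ mExp n q (fun π => ind (π.SameCycle s t)) := by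
  have hq : 1 / 2 ≤ q := by linarith
  have hq0 : 0 < q := by linarith
  have hst' : (s : ℕ) ≤ t := hst
  have hnR : (256 : ℝ) ≤ n := by exact_mod_cast hn
  have hinv : ∀ τ : ℕ, τ ≤ s + N + 1 → 1 / qn q (n - τ) ≤ 4 / n + (1 - q) := by
    intro τ hτ
    have h1 := inv_qn_le hq0 hq1 (m := n - τ) (by omega)
    refine h1.trans ?_
    have h2 : n ≤ 4 * (n - τ) := by omega
    have h2' : (n : ℝ) ≤ 4 * ((n - τ : ℕ) : ℝ) := by exact_mod_cast h2
    have h3 : 1 / ((n - τ : ℕ) : ℝ) ≤ 4 / n := by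
      rw [div_le_div_iff₀ (by linarith) (by linarith)]
      linarith
    linarith
  have h4n : (4 : ℝ) / n ≤ 1 / 64 := by
    rw [div_le_div_iff₀ (by linarith) (by norm_num)]
    linarith
  have hinv8 : ∀ τ : ℕ, τ ≤ s + N + 1 → 1 / qn q (n - τ) ≤ 1 / 8 := by
    intro τ hτ
    have := hinv τ hτ
    linarith
  have hqn : ∀ τ : ℕ, 0 ≤ 1 / qn q (n - τ) := by
    intro τ
    unfold qn
    positivity
  have hlam : ∀ τ : ℕ, τ ≤ s + N + 1 → lam q n τ ≤ 2 * ((4 / n) ^ 2 + (1 - q) ^ 2) := by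
    intro τ hτ
    unfold lam
    calc _ ≤ (4 / (n : ℝ) + (1 - q)) ^ 2 := pow_le_pow_left₀ (hqn τ) (hinv τ hτ) 2
      _ ≤ _ := by nlinarith [sq_nonneg (4 / (n : ℝ) - (1 - q))]
  have hsum : ∑ τ ∈ Finset.Ico ((s : ℕ) + 1) (s + N + 1), lam q n τ ≤ 1 / 16 := by
    calc _ ≤ ∑ τ ∈ Finset.Ico ((s : ℕ) + 1) (s + N + 1), 2 * ((4 / (n : ℝ)) ^ 2 + (1 - q) ^ 2) := by
          apply Finset.sum_le_sum
          intro τ hτ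
          rw [Finset.mem_Ico] at hτ
          exact hlam τ (by omega)
      _ = N * (2 * ((4 / (n : ℝ)) ^ 2 + (1 - q) ^ 2)) := by
          rw [Finset.sum_const, Nat.card_Ico, nsmul_eq_mul]
          congr 2
          omega
      _ ≤ 1 / 16 := by
          have hN2' : 8 * (N : ℝ) ≤ n := by exact_mod_cast hN2
          have b1 : (N : ℝ) * (4 / n) ≤ 1 / 2 := by
            rw [mul_div_assoc', div_le_iff₀ (by linarith)]
            linarith
          have b2 : (N : ℝ) * (4 / n) * (4 / n) ≤ 1 / 2 * (1 / 64) :=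
            mul_le_mul b1 h4n (by positivity) (by norm_num)
          nlinarith
  obtain ⟨U, hU, hU1, hU2⟩ := exists_U (lam q n) n (s + N) (lam_nonneg q n)
    (fun τ h1 h2 => lam_step hq0 hq1 h1 h2) (lam_last q (by omega)) (by omega) (by
      have := pow_le_pow_left₀ (hqn (s + N + 1)) (hinv8 (s + N + 1) le_rfl) 2
      unfold lam
      norm_num at this ⊢
      linarith)
  have hnot : ∀ r : Fin n, s ≤ r → (r : ℕ) ≤ s + N → ∀ τ ∈ Finset.Ico ((s : ℕ) + N + 1) U,
      mExp n q (fun π => ind (¬ Op τ π r)) ≤ 1 / 4 := by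
    intro r hr1 hr2 τ hτ
    have hr1' : (s : ℕ) ≤ r := hr1
    rw [Finset.mem_Ico] at hτ
    have c1 := not_op_le hq0 hq1 r τ (by omega) (by omega)
    have c2 := hinv8 r (by omega)
    rw [← Finset.sum_Ico_consecutive _ (show (r : ℕ) + 1 ≤ s + N + 1 by omega) hτ.1] at c1
    have c3 : ∑ τ ∈ Finset.Ico ((r : ℕ) + 1) (s + N + 1), lam q n τ
        ≤ ∑ τ ∈ Finset.Ico ((s : ℕ) + 1) (s + N + 1), lam q n τ :=
      Finset.sum_le_sum_of_subset_of_nonneg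
        (Finset.Ico_subset_Ico (by omega) le_rfl) (fun i _ _ => lam_nonneg q n i)
    have c4 : ∑ τ ∈ Finset.Ico ((s : ℕ) + N + 1) τ, lam q n τ
        ≤ ∑ τ ∈ Finset.Ico ((s : ℕ) + N + 1) U, lam q n τ :=
      Finset.sum_le_sum_of_subset_of_nonneg
        (Finset.Ico_subset_Ico le_rfl (by omega)) (fun i _ _ => lam_nonneg q n i)
    linarith
  exact core hq hq1 s t (s + N) U (by omega) ht hU (hnot s le_rfl (by omega))
    (hnot t hst ht) hU1

lemma card_exp {n : ℕ} {q : ℝ} (s : Fin n) :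
    mExp n q (fun π => ((cycleSet n π s).card : ℝ))
      = ∑ j : Fin n, mExp n q (fun π => ind (π.SameCycle s j)) := by
  rw [← mExp_sum]
  exact mExp_congr fun π => card_cycleSet π s

lemma half_lower {n : ℕ} {q : ℝ} (hq1 : q < 1) (hp : 1 - q ≤ 1 / 16) (hn : 256 ≤ n)
    (s : Fin n) (hs : 2 * (s : ℕ) + 1 ≤ n) (N : ℕ) (hN1 : 64 * (1 - q) ^ 2 * N ≤ 1)
    (hN2 : 8 * N ≤ n) :
    N * (Real.exp (-16) / 640) ≤ mExp n q (fun π => ((cycleSet n π s).card : ℝ)) := by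
  have hq0 : 0 < q := by linarith
  rw [card_exp]
  calc _ = ∑ j ∈ Finset.Ioc s (⟨s + N, by omega⟩ : Fin n), Real.exp (-16) / 640 := by
        rw [Finset.sum_const, Fin.card_Ioc, nsmul_eq_mul]
        congr 2
        simp
    _ ≤ ∑ j ∈ Finset.Ioc s (⟨s + N, by omega⟩ : Fin n),
          mExp n q (fun π => ind (π.SameCycle s j)) := by
        apply Finset.sum_le_sum
        intro j hj
        rw [Finset.mem_Ioc] at hj
        exact pair_lower hq1 hp hn s j hs N hN1 hN2 hj.1.le hj.2
    _ ≤ _ := Finset.sum_le_sum_of_subset_of_nonneg (Finset.subset_univ _)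
        (fun j _ _ => mExp_nonneg hq0 fun π => ind_nonneg _)

lemma card_rev {n : ℕ} {q : ℝ} (s : Fin n) :
    mExp n q (fun π => ((cycleSet n π s.rev).card : ℝ))
      = mExp n q (fun π => ((cycleSet n π s).card : ℝ)) := by
  rw [card_exp, card_exp, ← Equiv.sum_comp (Fin.revPerm : Equiv.Perm (Fin n))]
  apply Finset.sum_congr rfl
  intro j _
  rw [← mExp_rev]
  apply mExp_congr
  intro π
  rw [sameCycle_rev]
  simp

lemma lower_bound {n : ℕ} {q : ℝ} (hq : 0 < q) (hq1 : q < 1) (s : Fin n) :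
    Real.exp (-16) / 640 / 128 * min (((1 - q) ^ 2)⁻¹) (n : ℝ)
      ≤ mExp n q (fun π => ((cycleSet n π s).card : ℝ)) := by
  have hp : 0 < 1 - q := by linarith
  have e1 : Real.exp (-16) ≤ 1 := Real.exp_le_one_iff.2 (by norm_num)
  have e0 := Real.exp_pos (-16)
  have hm1 := min_le_left (((1 - q) ^ 2)⁻¹) (n : ℝ)
  have hm2 := min_le_right (((1 - q) ^ 2)⁻¹) (n : ℝ)
  have hm0 : 0 ≤ min (((1 - q) ^ 2)⁻¹) (n : ℝ) := le_min (by positivity) (Nat.cast_nonneg _)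
  have hbig : 256 ≤ n → 1 - q ≤ 1 / 16 → 256 ≤ min (((1 - q) ^ 2)⁻¹) (n : ℝ) := by
    intro h1 h2
    refine le_min ?_ (by exact_mod_cast h1)
    rw [le_inv_comm₀ (by norm_num) (by positivity)]
    nlinarith
  have hone : 1 ≤ mExp n q (fun π => ((cycleSet n π s).card : ℝ)) := by
    rw [← mExp_const (n := n) hq 1]
    apply mExp_mono hq
    intro π
    exact_mod_cast Finset.card_pos.2 ⟨s, self_mem_cycleSet n π s⟩
  have hsmall : min (((1 - q) ^ 2)⁻¹) (n : ℝ) ≤ 256 → Real.exp (-16) / 640 / 128 *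
      min (((1 - q) ^ 2)⁻¹) (n : ℝ) ≤ mExp n q (fun π => ((cycleSet n π s).card : ℝ)) := by
    intro h
    have : Real.exp (-16) / 640 / 128 * min (((1 - q) ^ 2)⁻¹) (n : ℝ) ≤ 1 / 640 / 128 * 256 :=
      mul_le_mul (by linarith) h hm0 (by norm_num)
    linarith
  generalize hm : min (((1 - q) ^ 2)⁻¹) (n : ℝ) = m at *
  by_cases h1 : 256 ≤ n
  swap
  · apply hsmall
    have : (n : ℝ) ≤ 256 := by exact_mod_cast (not_le.1 h1).le
    linarith
  by_cases h2 : 1 - q ≤ 1 / 16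
  swap
  · apply hsmall
    refine hm1.trans ?_
    rw [inv_le_comm₀ (by positivity) (by norm_num)]
    nlinarith
  have h256 := hbig h1 h2
  have hN1 := Nat.floor_le (show 0 ≤ m / 64 by positivity)
  have hN2 := Nat.lt_floor_add_one (m / 64)
  generalize ⌊m / 64⌋₊ = N at hN1 hN2
  have hA : 64 * (1 - q) ^ 2 * N ≤ 1 := by
    have : 64 * (N : ℝ) ≤ ((1 - q) ^ 2)⁻¹ := by linarith
    rw [le_inv_comm₀ (by nlinarith) (by positivity), ← one_div,
      le_div_iff₀ (by nlinarith)] at this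
    linarith
  have hB : 8 * N ≤ n := by
    have : (8 : ℝ) * N ≤ n := by linarith [Nat.cast_nonneg (α := ℝ) N]
    exact_mod_cast this
  have key : N * (Real.exp (-16) / 640) ≤ mExp n q (fun π => ((cycleSet n π s).card : ℝ)) := by
    by_cases hs : 2 * (s : ℕ) + 1 ≤ n
    · exact half_lower hq1 h2 h1 s hs N hA hB
    · rw [← card_rev]
      apply half_lower hq1 h2 h1 s.rev _ N hA hB
      rw [Fin.val_rev]
      omega
  refine le_trans ?_ key
  have : m / 128 ≤ N := by linarith
  have := mul_le_mul_of_nonneg_right this (show 0 ≤ Real.exp (-16) / 640 by positivity)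
  linarith

theorem mallows_expected_cycle_length :
    ∃ c C : ℝ, 0 < c ∧ 0 < C ∧
      ∀ (n : ℕ) (q : ℝ), 1 ≤ n → 0 < q → q < 1 → ∀ s : Fin n,
        c * min (((1 - q) ^ 2)⁻¹) (n : ℝ)
            ≤ mExp n q (fun π => ((cycleSet n π s).card : ℝ)) ∧
          mExp n q (fun π => ((cycleSet n π s).card : ℝ))
            ≤ C * min (((1 - q) ^ 2)⁻¹) (n : ℝ) := by
  refine ⟨Real.exp (-16) / 640 / 128, 13, by positivity, by norm_num, ?_⟩
  intro n q hn hq hq1 s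
  refine ⟨lower_bound hq hq1 s, ?_⟩
  rw [mul_min_of_nonneg _ _ (by norm_num : (0 : ℝ) ≤ 13)]
  refine le_min (upper_bound hq hq1 s) ?_
  have : mExp n q (fun π => ((cycleSet n π s).card : ℝ)) ≤ mExp n q (fun _ => (n : ℝ)) := by
    apply mExp_mono hq
    intro π
    have := Finset.card_le_univ (cycleSet n π s)
    rw [Fintype.card_fin] at this
    exact_mod_cast this
  rw [mExp_const hq] at this
  have : (0 : ℝ) ≤ n := Nat.cast_nonneg _
  linarith
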